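/- Let k, m ∈ ℕ and let α ∈ (k−1, k) be a non-integer real with α + m > 1/2. There exists a constant C > 0, depending only on α and m, such that for every integer p with α + m < p + 1 and every ω ∈ 𝒰^{α,m}_{1−}((−1,1)), the Gauss–Radau projections satisfy |ω(−1) − (Π_p^− ω)(−1)| ≤ C · p^{−min{2α, α+m−1/2}} · U^{α,m}_{1−}(ω;(−1,1)) and |ω(1) − (Π_p^+ ω)(1)| ≤ C · p^{−min{2α, α+m−1/2}} · U^{α,m}_{1−}(ω;(−1,1)), where the pointwise values of ω at ±1 are those of its continuous representative on [−1,1]. -/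

import Mathlib

open MeasureTheory Set Filter

/-- The right Caputo fractional derivative of order `α ∈ (k−1,k)` based at `b`:
`(^C D^α_{b−} u)(x) = ((−1)^k/Γ(k−α)) ∫_x^b (y−x)^{k−α−1} u^{(k)}(y) dy`. -/
noncomputable def caputoR (k : ℕ) (α b : ℝ) (u : ℝ → ℝ) (x : ℝ) : ℝ :=
  ((-1 : ℝ) ^ k / Real.Gamma ((k : ℝ) - α)) *
    ∫ y in x..b, (y - x) ^ ((k : ℝ) - α - 1) * iteratedDeriv k u y

/-- Membership `ω ∈ 𝒰^{α,m}_{1−}((−1,1))`: `ω ∈ W^{k,1}(−1,1)` and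
`^C D^α_{1−} ω ∈ W^{m,1}(−1,1)`, with `L i` the (finite) left-hand limits
`D^i(^C D^α_{1−} ω)(1−)` for `i < m`. -/
def MemUR (k m : ℕ) (α : ℝ) (ω : ℝ → ℝ) (L : ℕ → ℝ) : Prop :=
  ContinuousOn ω (Icc (-1 : ℝ) 1) ∧
  (∀ i < k, ∀ x ∈ Ioo (-1 : ℝ) 1,
      HasDerivAt (iteratedDeriv i ω) (iteratedDeriv (i + 1) ω x) x) ∧
  (∀ i ≤ k, IntervalIntegrable (iteratedDeriv i ω) volume (-1) 1) ∧
  (∀ i < m, ∀ x ∈ Ioo (-1 : ℝ) 1,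
      HasDerivAt (iteratedDeriv i (caputoR k α 1 ω))
        (iteratedDeriv (i + 1) (caputoR k α 1 ω) x) x) ∧
  (∀ i ≤ m, IntervalIntegrable (iteratedDeriv i (caputoR k α 1 ω)) volume (-1) 1) ∧
  (∀ i < m, Tendsto (iteratedDeriv i (caputoR k α 1 ω))
      (nhdsWithin (1 : ℝ) (Iio 1)) (nhds (L i)))

/-- The semi-norm `U^{α,m}_{1−}(ω;(−1,1))`. -/
noncomputable def UsemiR (k m : ℕ) (α : ℝ) (ω : ℝ → ℝ) (L : ℕ → ℝ) : ℝ :=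
  (∫ x in (-1 : ℝ)..1, |iteratedDeriv m (caputoR k α 1 ω) x|) +
    ∑ i ∈ Finset.range m, |L i|

/-- The Legendre polynomials, normalised by `P_n(1) = 1`. -/
noncomputable def legendreP : ℕ → Polynomial ℝ
  | 0 => 1
  | 1 => Polynomial.X
  | n + 2 => Polynomial.C ((2 * n + 3 : ℝ) / (n + 2)) * Polynomial.X * legendreP (n + 1) -
      Polynomial.C ((n + 1 : ℝ) / (n + 2)) * legendreP n

lemma legendreP_recurrence (n : ℕ) (x : ℝ) :
    (n + 2 : ℝ) * (legendreP (n + 2)).eval x =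
      (2 * n + 3) * x * (legendreP (n + 1)).eval x - (n + 1) * (legendreP n).eval x := by
  have : (n + 2 : ℝ) ≠ 0 := by positivity
  simp only [legendreP, Polynomial.eval_sub, Polynomial.eval_mul, Polynomial.eval_C,
    Polynomial.eval_X]
  field_simp

lemma legendreP_derivative_recurrence (n : ℕ) (x : ℝ) :
    (n + 2 : ℝ) * (legendreP (n + 2)).derivative.eval x =
      (2 * n + 3) * ((legendreP (n + 1)).eval x + x * (legendreP (n + 1)).derivative.eval x) -
        (n + 1) * (legendreP n).derivative.eval x := by
  have : (n + 2 : ℝ) ≠ 0 := by positivity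
  simp only [legendreP, Polynomial.derivative_sub, Polynomial.derivative_mul,
    Polynomial.derivative_C, Polynomial.derivative_X, Polynomial.eval_sub, Polynomial.eval_add,
    Polynomial.eval_mul, Polynomial.eval_C, Polynomial.eval_X, Polynomial.eval_zero,
    Polynomial.eval_one]
  field_simp
  ring

lemma legendreP_derivative_relations (n : ℕ) (x : ℝ) :
    x * (legendreP (n + 1)).derivative.eval x - (legendreP n).derivative.eval x =
        (n + 1) * (legendreP (n + 1)).eval x ∧
      (legendreP (n + 1)).derivative.eval x - x * (legendreP n).derivative.eval x =
        (n + 1) * (legendreP n).eval x := by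
  induction n with
  | zero => simp [legendreP]
  | succ n ih =>
    obtain ⟨h1, h2⟩ := ih
    have r := legendreP_recurrence n x
    have d := legendreP_derivative_recurrence n x
    have hn : (n + 2 : ℝ) ≠ 0 := by positivity
    have h4 : (legendreP (n + 2)).derivative.eval x - x * (legendreP (n + 1)).derivative.eval x =
        (n + 2) * (legendreP (n + 1)).eval x := by
      apply mul_left_cancel₀ hn
      linear_combination d + (n + 1) * h1
    push_cast
    refine ⟨?_, by linear_combination h4⟩
    linear_combination x * h4 + x * h1 - h2 - r

lemma legendreP_eval_one (n : ℕ) : (legendreP n).eval 1 = 1 := by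
  induction n using Nat.twoStepInduction with
  | zero => simp [legendreP]
  | one => simp [legendreP]
  | more n h0 h1 =>
    have r := legendreP_recurrence n 1
    rw [h0, h1] at r
    have hn : (n + 2 : ℝ) ≠ 0 := by positivity
    apply mul_left_cancel₀ hn
    linear_combination r

lemma legendreP_eval_neg (n : ℕ) (x : ℝ) :
    (legendreP n).eval (-x) = (-1) ^ n * (legendreP n).eval x := by
  induction n using Nat.twoStepInduction with
  | zero => simp [legendreP]
  | one => simp [legendreP]
  | more n h0 h1 =>
    have r := legendreP_recurrence n x
    have r' := legendreP_recurrence n (-x)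
    rw [h0, h1] at r'
    have hn : (n + 2 : ℝ) ≠ 0 := by positivity
    apply mul_left_cancel₀ hn
    rw [pow_succ, pow_succ]
    rw [pow_succ] at r'
    linear_combination r' - (-1) ^ n * r

lemma legendreP_eval_neg_one (n : ℕ) : (legendreP n).eval (-1) = (-1) ^ n := by
  rw [legendreP_eval_neg, legendreP_eval_one, mul_one]

lemma natDegree_legendreP_le (n : ℕ) : (legendreP n).natDegree ≤ n := by
  induction n using Nat.twoStepInduction with
  | zero => simp [legendreP]
  | one => simp [legendreP]
  | more n h0 h1 =>
    rw [legendreP]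
    compute_degree
    · refine max_le ?_ (by omega)
      omega

lemma legendreP_mul_derivative (n : ℕ) (x : ℝ) :
    (1 - x ^ 2) * (legendreP (n + 1)).derivative.eval x =
      (n + 1) * ((legendreP n).eval x - x * (legendreP (n + 1)).eval x) := by
  obtain ⟨h1, h2⟩ := legendreP_derivative_relations n x
  linear_combination h2 - x * h1

/-- Legendre's differential equation. -/
lemma legendreP_ode (n : ℕ) (x : ℝ) :
    (1 - x ^ 2) * (legendreP (n + 1)).derivative.derivative.eval x =
      2 * x * (legendreP (n + 1)).derivative.eval x -
        (n + 1) * (n + 2) * (legendreP (n + 1)).eval x := by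
  have h : (1 - Polynomial.X ^ 2) * (legendreP (n + 1)).derivative =
      Polynomial.C (n + 1 : ℝ) * (legendreP n - Polynomial.X * legendreP (n + 1)) := by
    apply Polynomial.funext
    intro y
    simpa using legendreP_mul_derivative n y
  have h' := congrArg (fun q => q.derivative.eval x) h
  simp at h'
  obtain ⟨h1, h2⟩ := legendreP_derivative_relations n x
  linear_combination h' - (n + 1) * h1

/-- The antiderivative of `legendreP (n + 1)` vanishing at `± 1`. -/
noncomputable def legendrePrim (n : ℕ) : Polynomial ℝ :=
  Polynomial.C (1 / (2 * n + 3 : ℝ)) * (legendreP (n + 2) - legendreP n)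

lemma derivative_legendrePrim (n : ℕ) : (legendrePrim n).derivative = legendreP (n + 1) := by
  apply Polynomial.funext
  intro x
  have h1 := (legendreP_derivative_relations n x).1
  have h2 := (legendreP_derivative_relations (n + 1) x).2
  have hn : (2 * n + 3 : ℝ) ≠ 0 := by positivity
  push_cast at h2
  simp [legendrePrim]
  field_simp
  linear_combination h1 + h2

lemma legendrePrim_eval_one (n : ℕ) : (legendrePrim n).eval 1 = 0 := by
  simp [legendrePrim, legendreP_eval_one]

lemma legendrePrim_eval_neg_one (n : ℕ) : (legendrePrim n).eval (-1) = 0 := by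
  simp [legendrePrim, legendreP_eval_neg_one, pow_add]

lemma legendrePrim_eval (n : ℕ) (x : ℝ) :
    (legendrePrim n).eval x =
      -((1 - x ^ 2) * (legendreP (n + 1)).derivative.eval x) / ((n + 1) * (n + 2)) := by
  rw [legendreP_mul_derivative]
  have r := legendreP_recurrence n x
  have hn : (2 * n + 3 : ℝ) ≠ 0 := by positivity
  have hn1 : (n + 1 : ℝ) ≠ 0 := by positivity
  have hn2 : (n + 2 : ℝ) ≠ 0 := by positivity
  simp [legendrePrim]
  field_simp
  linear_combination r

lemma integral_derivative_mul_legendreP (f g F : Polynomial ℝ) (a b : ℝ) (hF : F.derivative = f) :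
    ∫ x in a..b, g.eval x * f.eval x =
      g.eval b * F.eval b - g.eval a * F.eval a - ∫ x in a..b, g.derivative.eval x * F.eval x := by
  subst hF
  exact intervalIntegral.integral_mul_deriv_eq_deriv_mul (fun x _ => g.hasDerivAt x)
    (fun x _ => F.hasDerivAt x) (g.derivative.continuous.intervalIntegrable _ _)
    (F.derivative.continuous.intervalIntegrable _ _)

lemma integral_mul_legendreP_eq_zero (n : ℕ) (v : Polynomial ℝ) (hv : v.natDegree < n) :
    ∫ x in (-1 : ℝ)..1, v.eval x * (legendreP n).eval x = 0 := by
  induction h : v.natDegree using Nat.strong_induction_on generalizing n v with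
  | _ d ih =>
    obtain ⟨n, rfl⟩ : ∃ j, n = j + 1 := ⟨n - 1, by omega⟩
    rw [integral_derivative_mul_legendreP _ v (legendrePrim n) _ _ (derivative_legendrePrim n),
      legendrePrim_eval_one, legendrePrim_eval_neg_one]
    rcases Nat.eq_zero_or_pos d with hd | hd
    · have : v.derivative = 0 := Polynomial.derivative_of_natDegree_zero (h.trans hd)
      simp [this]
    · have hlt : v.derivative.natDegree < d := h ▸ Polynomial.natDegree_derivative_lt (by omega)
      have e1 := ih _ hlt (n + 2) v.derivative (by omega) rfl
      have e2 := ih _ hlt n v.derivative (by omega) rfl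
      have : ∀ x, v.derivative.eval x * (legendrePrim n).eval x = (1 / (2 * n + 3 : ℝ)) *
          (v.derivative.eval x * (legendreP (n + 2)).eval x -
            v.derivative.eval x * (legendreP n).eval x) := by
        intro x; simp [legendrePrim]; ring
      simp_rw [this]
      rw [intervalIntegral.integral_const_mul, intervalIntegral.integral_sub, e1, e2]
      · simp
      · exact (v.derivative.continuous.mul (legendreP (n + 2)).continuous).intervalIntegrable _ _
      · exact (v.derivative.continuous.mul (legendreP n).continuous).intervalIntegrable _ _

lemma legendreP_derivative_eval_neg (n : ℕ) (x : ℝ) :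
    (legendreP (n + 1)).derivative.eval (-x) =
      (-1) ^ n * (legendreP (n + 1)).derivative.eval x := by
  obtain ⟨c, hc⟩ : ∃ c : ℝ, c = (-1) ^ n := ⟨_, rfl⟩
  have h : (legendreP (n + 1)).comp (-Polynomial.X) = Polynomial.C (-c) * legendreP (n + 1) := by
    apply Polynomial.funext
    intro y
    simp [legendreP_eval_neg, hc, pow_succ]
  have h' := congrArg (fun r => r.derivative.eval x) h
  simp [Polynomial.derivative_comp] at h'
  rw [← hc, h']

lemma legendreP_energy_le (n : ℕ) {x : ℝ} (hx : x ∈ Icc (-1 : ℝ) 1) :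
    (legendreP (n + 1)).eval x ^ 2 +
      (1 - x ^ 2) * (legendreP (n + 1)).derivative.eval x ^ 2 / ((n + 1) * (n + 2)) ≤ 1 := by
  set q := legendreP (n + 1) with hq
  have hN : (0 : ℝ) < (n + 1) * (n + 2) := by positivity
  have key : ∀ y ∈ Icc (0 : ℝ) 1, q.eval y ^ 2 +
      (1 - y ^ 2) * q.derivative.eval y ^ 2 / ((n + 1) * (n + 2)) ≤ 1 := by
    have hd : ∀ y : ℝ, HasDerivAt (fun y => q.eval y ^ 2 +
        (1 - y ^ 2) * q.derivative.eval y ^ 2 / ((n + 1) * (n + 2)))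
        (2 * y * q.derivative.eval y ^ 2 / ((n + 1) * (n + 2))) y := by
      intro y
      have := ((q.hasDerivAt y).pow 2).add
        (((((hasDerivAt_id y).pow 2).const_sub 1).mul ((q.derivative.hasDerivAt y).pow 2)).div_const
          ((n + 1) * (n + 2) : ℝ))
      refine this.congr_deriv ?_
      have ode := legendreP_ode n y
      rw [← hq] at ode
      simp
      field_simp
      linear_combination q.derivative.eval y * ode
    have hmono : MonotoneOn (fun y => q.eval y ^ 2 +
        (1 - y ^ 2) * q.derivative.eval y ^ 2 / ((n + 1) * (n + 2))) (Icc (0 : ℝ) 1) := by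
      refine monotoneOn_of_deriv_nonneg (convex_Icc _ _)
        (fun y _ => (hd y).continuousAt.continuousWithinAt)
        (fun y _ => (hd y).differentiableAt.differentiableWithinAt) ?_
      intro y hy
      rw [interior_Icc] at hy
      rw [(hd y).deriv]
      have := hy.1
      positivity
    intro y hy
    have := hmono hy (right_mem_Icc.2 zero_le_one) hy.2
    simpa [hq, legendreP_eval_one] using this
  rcases le_total 0 x with h | h
  · exact key x ⟨h, hx.2⟩
  · have := key (-x) ⟨by linarith, by linarith [hx.1]⟩
    have e1 : q.eval (-x) ^ 2 = q.eval x ^ 2 := by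
      rw [hq, legendreP_eval_neg, mul_pow, ← pow_mul, mul_comm (n + 1), pow_mul]; simp
    have e2 : q.derivative.eval (-x) ^ 2 = q.derivative.eval x ^ 2 := by
      rw [hq, legendreP_derivative_eval_neg, mul_pow, ← pow_mul, mul_comm n, pow_mul]; simp
    rwa [neg_sq, e1, e2] at this

lemma abs_legendreP_le_one (n : ℕ) {x : ℝ} (hx : x ∈ Icc (-1 : ℝ) 1) :
    |(legendreP (n + 1)).eval x| ≤ 1 := by
  have h := legendreP_energy_le n hx
  have : 0 ≤ 1 - x ^ 2 := by nlinarith [hx.1, hx.2]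
  have h2 : 0 ≤ (1 - x ^ 2) * (legendreP (n + 1)).derivative.eval x ^ 2 / ((n + 1) * (n + 2)) := by
    positivity
  exact (sq_le_one_iff_abs_le_one _).1 (by linarith)

lemma legendreP_eval_zero_sq_le (n : ℕ) : (n + 1 : ℝ) * (legendreP n).eval 0 ^ 2 ≤ 1 := by
  induction n using Nat.twoStepInduction with
  | zero => simp [legendreP]
  | one => simp [legendreP]
  | more n h0 h1 =>
    have r := legendreP_recurrence n 0
    set a := (legendreP n).eval 0
    set b := (legendreP (n + 2)).eval 0
    have hb : b = -((n + 1) / (n + 2)) * a := by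
      field_simp
      linear_combination r
    rw [hb]
    push_cast
    have : (n + 2 + 1 : ℝ) * (-((n + 1) / (n + 2)) * a) ^ 2 =
        ((n + 3) * (n + 1) / (n + 2) ^ 2) * ((n + 1) * a ^ 2) := by
      field_simp; ring
    rw [this]
    have h3 : ((n + 3) * (n + 1) / (n + 2) ^ 2 : ℝ) ≤ 1 := by
      rw [div_le_one (by positivity)]; nlinarith
    exact mul_le_one₀ h3 (by positivity) h0

/-- The Sonin-type bound behind Bernstein's inequality for Legendre polynomials. -/
lemma legendreP_sonin_le (n : ℕ) {x : ℝ} (hx : x ∈ Icc (-1 : ℝ) 1) :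
    √(1 - x ^ 2) * ((legendreP (n + 1)).eval x ^ 2 +
      (2 * (1 - x ^ 2) * (legendreP (n + 1)).derivative.eval x -
        x * (legendreP (n + 1)).eval x) ^ 2 /
          ((4 * ((n + 1) * (n + 2)) + 1) * (1 - x ^ 2) + 1)) ≤ 2 / (n + 1) := by
  set q := legendreP (n + 1) with hq
  set N : ℝ := (n + 1) * (n + 2) with hN
  have hN0 : 0 < N := by positivity
  set Q : ℝ → ℝ := fun y => q.eval y ^ 2 + (2 * (1 - y ^ 2) * q.derivative.eval y -
    y * q.eval y) ^ 2 / ((4 * N + 1) * (1 - y ^ 2) + 1) with hQ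
  have hQ0 : ∀ y ∈ Icc (-1 : ℝ) 1, 0 ≤ Q y := by
    intro y hy
    have : 0 ≤ 1 - y ^ 2 := by nlinarith [hy.1, hy.2]
    simp only [hQ]; positivity
  have hzero : Q 0 ≤ 2 / (n + 1) := by
    have h1 := legendreP_eval_zero_sq_le (n + 1)
    have h2 := legendreP_eval_zero_sq_le n
    have h3 := (legendreP_derivative_relations n 0).2
    rw [← hq] at h1 h3
    push_cast at h1
    simp only [hQ]
    have h4 : q.derivative.eval 0 = (n + 1) * (legendreP n).eval 0 := by linear_combination h3
    rw [h4]
    set a := q.eval 0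
    set b := (legendreP n).eval 0
    have ha : a ^ 2 ≤ 1 / (n + 1) := by
      rw [le_div_iff₀ (by positivity)]; nlinarith [sq_nonneg a]
    have hb : (2 * (1 - 0 ^ 2) * ((n + 1) * b) - 0 * a) ^ 2 / ((4 * N + 1) * (1 - 0 ^ 2) + 1) ≤
        1 / (n + 1) := by
      rw [div_le_div_iff₀ (by positivity) (by positivity)]
      have : (n + 1 : ℝ) ^ 2 * ((n + 1) * b ^ 2) ≤ (n + 1 : ℝ) ^ 2 * 1 := by gcongr
      nlinarith
    calc _ ≤ 1 / (n + 1) + 1 / (n + 1 : ℝ) := add_le_add ha hb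
      _ = _ := by ring
  have hd : ∀ y ∈ Icc (0 : ℝ) 1, HasDerivAt (fun y => (1 - y ^ 2) * Q y ^ 2)
      (-(4 * y * Q y * (2 * (1 - y ^ 2) * q.derivative.eval y - y * q.eval y) ^ 2 /
        ((4 * N + 1) * (1 - y ^ 2) + 1) ^ 2)) y := by
    intro y hy
    have hy2 : 0 ≤ 1 - y ^ 2 := by nlinarith [hy.1, hy.2]
    have hD : (4 * N + 1) * (1 - y ^ 2) + 1 ≠ 0 := by positivity
    have h1 := ((hasDerivAt_id y).pow 2).const_sub 1
    have hv := ((h1.const_mul 2).mul (q.derivative.hasDerivAt y)).sub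
      ((hasDerivAt_id y).mul (q.hasDerivAt y))
    have hQd := ((q.hasDerivAt y).pow 2).add
      ((hv.pow 2).div ((h1.const_mul (4 * N + 1)).add_const 1) hD)
    have := h1.mul (hQd.pow 2)
    refine this.congr_deriv ?_
    have ode : (1 - y ^ 2) * q.derivative.derivative.eval y =
      2 * y * q.derivative.eval y - N * q.eval y := legendreP_ode n y
    simp only [hQ]
    simp
    generalize q.derivative.derivative.eval y = c at *
    generalize q.derivative.eval y = b at *
    generalize q.eval y = a at *
    have e1 : c * (1 - y ^ 2) = 2 * y * b - N * a := by linear_combination ode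
    set v := 2 * (1 - y ^ 2) * b - y * a with hv
    have e2 : -(2 * (2 * y) * b) + 2 * (1 - y ^ 2) * c - (a + y * b) =
        -y * b - (2 * N + 1) * a := by linear_combination 2 * e1
    rw [e2]
    set D := (4 * N + 1) * (1 - y ^ 2) + 1 with hD'
    have key : (1 - y ^ 2) * (2 * a * b + (2 * v * (-y * b - (2 * N + 1) * a) * D -
        v ^ 2 * (-((4 * N + 1) * (2 * y)))) / D ^ 2) - y * (a ^ 2 + v ^ 2 / D) =
        -(2 * y * v ^ 2 / D ^ 2) := by
      have e3 : (1 - y ^ 2) * (-y * b - (2 * N + 1) * a) = -y * v / 2 - a * D / 2 := by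
        rw [hv, hD']; ring
      have e4 : (1 - y ^ 2) * b = (v + y * a) / 2 := by rw [hv]; ring
      have e5 : (4 * N + 1) * (1 - y ^ 2) = D - 1 := by rw [hD']; ring
      field_simp
      linear_combination (2 * a * D ^ 2) * e4 + 2 * v * D * e3 + 2 * y * v ^ 2 * e5
    linear_combination 2 * (a ^ 2 + v ^ 2 / D) * key
  have hanti : AntitoneOn (fun y => (1 - y ^ 2) * Q y ^ 2) (Icc (0 : ℝ) 1) := by
    refine antitoneOn_of_deriv_nonpos (convex_Icc _ _)
      (fun y hy => (hd y hy).continuousAt.continuousWithinAt)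
      (fun y hy => (hd y (interior_subset hy)).differentiableAt.differentiableWithinAt) ?_
    intro y hy
    have hy' := interior_subset hy
    rw [(hd y hy').deriv, neg_nonpos]
    have := hQ0 y ⟨by linarith [hy'.1], hy'.2⟩
    have := hy'.1
    positivity
  have key : ∀ y ∈ Icc (0 : ℝ) 1, √(1 - y ^ 2) * Q y ≤ 2 / (n + 1) := by
    intro y hy
    have h1 := hanti (left_mem_Icc.2 zero_le_one) hy hy.1
    have hy2 : 0 ≤ 1 - y ^ 2 := by nlinarith [hy.1, hy.2]
    have h0 := hQ0 0 (by simp)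
    refine le_trans (abs_le_of_sq_le_sq' ?_ h0).2 hzero
    rw [mul_pow, Real.sq_sqrt hy2]
    simpa using h1
  change √(1 - x ^ 2) * Q x ≤ _
  rcases le_total 0 x with h | h
  · exact key x ⟨h, hx.2⟩
  · have := key (-x) ⟨by linarith, by linarith [hx.1]⟩
    have hs : ((-1 : ℝ) ^ (n + 1)) ^ 2 = 1 := by
      rw [← pow_mul, mul_comm (n + 1), pow_mul]; simp
    have e1 : q.eval (-x) = (-1) ^ (n + 1) * q.eval x := by
      rw [hq, legendreP_eval_neg]
    have e2 : q.derivative.eval (-x) = - ((-1) ^ (n + 1) * q.derivative.eval x) := by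
      rw [hq, legendreP_derivative_eval_neg]; ring
    have e3 : Q (-x) = Q x := by
      simp only [hQ, e1, e2, neg_sq]
      rw [mul_pow, hs, one_mul]
      congr 2
      linear_combination (2 * (1 - x ^ 2) * q.derivative.eval x - x * q.eval x) ^ 2 * hs
    rwa [neg_sq, e3] at this

/-- Bernstein's inequality. -/
lemma legendreP_sq_mul_sqrt_le (n : ℕ) {x : ℝ} (hx : x ∈ Icc (-1 : ℝ) 1) :
    √(1 - x ^ 2) * (legendreP (n + 1)).eval x ^ 2 ≤ 2 / (n + 1) := by
  refine le_trans ?_ (legendreP_sonin_le n hx)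
  have : 0 ≤ 1 - x ^ 2 := by nlinarith [hx.1, hx.2]
  gcongr
  exact le_add_of_nonneg_right (by positivity)

lemma legendrePrim_sq_le (n : ℕ) {x : ℝ} (hx : x ∈ Icc (-1 : ℝ) 1) :
    (legendrePrim n).eval x ^ 2 ≤ 11 * √(1 - x ^ 2) / (n + 1) ^ 3 := by
  have hx2 : 0 ≤ 1 - x ^ 2 := by nlinarith [hx.1, hx.2]
  have hH := legendreP_energy_le n hx
  have hS := legendreP_sonin_le n hx
  have hB := legendreP_sq_mul_sqrt_le n hx
  rw [legendrePrim_eval]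
  generalize (legendreP (n + 1)).derivative.eval x = b at *
  generalize (legendreP (n + 1)).eval x = a at *
  set w := √(1 - x ^ 2) with hw
  have hw2 : 1 - x ^ 2 = w ^ 2 := (Real.sq_sqrt hx2).symm
  have hw0 : 0 ≤ w := Real.sqrt_nonneg _
  rw [hw2] at hH hS ⊢
  obtain ⟨p, hp⟩ : ∃ p : ℝ, p = n + 1 := ⟨_, rfl⟩
  have hp2 : (n + 2 : ℝ) = p + 1 := by rw [hp]; ring
  rw [hp2, ← hp] at hH hS ⊢
  rw [← hp] at hB
  have hp1 : 1 ≤ p := by rw [hp]; linarith [n.cast_nonneg (α := ℝ)]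
  rw [div_pow, neg_sq, div_le_div_iff₀ (by positivity) (by positivity)]
  rcases le_total 1 (p * w) with h | h
  · have hwp : 0 < w := by
      by_contra hc
      have : w = 0 := le_antisymm (not_lt.1 hc) hw0
      rw [this] at h; linarith
    set v := 2 * w ^ 2 * b - x * a with hv
    set D := (4 * (p * (p + 1)) + 1) * w ^ 2 + 1 with hD
    have hD0 : 0 < D := by positivity
    have hDle : D ≤ 10 * p ^ 2 * w ^ 2 := by nlinarith
    have h1 : w * v ^ 2 / D ≤ 2 / p := by
      refine le_trans ?_ hS
      rw [mul_add, mul_div_assoc]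
      exact le_add_of_nonneg_left (by positivity)
    rw [div_le_div_iff₀ hD0 (by positivity)] at h1
    have hv2 : v ^ 2 ≤ 20 * p * w := by
      have : (w * p) * v ^ 2 ≤ (w * p) * (20 * p * w) := by nlinarith
      exact le_of_mul_le_mul_left this (by positivity)
    rw [le_div_iff₀ (by positivity)] at hB
    have ha2 : a ^ 2 ≤ 2 * p * w := by
      have : (w * p) * a ^ 2 ≤ (w * p) * (2 * p * w) := by nlinarith
      exact le_of_mul_le_mul_left this (by positivity)
    have hx1 : x ^ 2 ≤ 1 := by nlinarith
    have h3 : (2 * (w ^ 2 * b)) ^ 2 ≤ 44 * p * w := by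
      have : 2 * (w ^ 2 * b) = v + x * a := by rw [hv]; ring
      rw [this]
      have : x ^ 2 * a ^ 2 ≤ 1 * a ^ 2 := by gcongr
      nlinarith [sq_nonneg (v - x * a)]
    have h4 : (w ^ 2 * b) ^ 2 ≤ 11 * p * w := by nlinarith
    calc (w ^ 2 * b) ^ 2 * p ^ 3 ≤ 11 * p * w * p ^ 3 := by gcongr
      _ = 11 * w * (p * p) ^ 2 := by ring
      _ ≤ 11 * w * (p * (p + 1)) ^ 2 := by gcongr; linarith
  · have h1 : w ^ 2 * b ^ 2 / (p * (p + 1)) ≤ 1 := le_trans (le_add_of_nonneg_left (by positivity)) hH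
    rw [div_le_one (by positivity)] at h1
    calc (w ^ 2 * b) ^ 2 * p ^ 3 = w * (w ^ 2 * b ^ 2) * (p * w) * p ^ 2 := by ring
      _ ≤ w * (p * (p + 1)) * 1 * p ^ 2 := by gcongr
      _ ≤ w * (p * (p + 1)) * 11 * (p * (p + 1)) := by gcongr <;> nlinarith
      _ = _ := by ring

lemma intervalIntegrable_sub_rpow {r : ℝ} (hr : -1 < r) (y a b : ℝ) :
    IntervalIntegrable (fun x => (y - x) ^ r) volume a b := by
  have h := (intervalIntegral.intervalIntegrable_rpow' (a := y - a) (b := y - b) hr).comp_sub_left y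
    (by simp)
  simpa using h

lemma integral_sub_rpow {r : ℝ} (hr : -1 < r) (y a : ℝ) :
    ∫ x in a..y, (y - x) ^ r = (y - a) ^ (r + 1) / (r + 1) := by
  rw [intervalIntegral.integral_comp_sub_left (fun x => x ^ r), integral_rpow (Or.inl hr)]
  simp [Real.zero_rpow (by linarith : r + 1 ≠ 0)]

/-- The unnormalised left fractional integral of order `s` of a polynomial, based at `-1`. -/
noncomputable def polyFracInt (s : ℝ) (f : Polynomial ℝ) (y : ℝ) : ℝ :=
  ∫ x in (-1 : ℝ)..y, (y - x) ^ (s - 1) * f.eval x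

lemma abs_integral_sub_rpow_mul_le {σ a y M : ℝ} (hσ : 0 < σ) (hay : a ≤ y) (f : Polynomial ℝ)
    (hf : ∀ x, a ≤ x → x ≤ y → |f.eval x| ≤ M) :
    |∫ x in a..y, (y - x) ^ (σ - 1) * f.eval x| ≤ M * ((y - a) ^ σ / σ) := by
  have h := integral_sub_rpow (r := σ - 1) (by linarith) y a
  rw [sub_add_cancel] at h
  rw [← h, ← intervalIntegral.integral_const_mul, ← Real.norm_eq_abs]
  refine intervalIntegral.norm_integral_le_of_norm_le hay (ae_of_all _ fun x hx => ?_)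
    ((intervalIntegrable_sub_rpow (by linarith) y a y).const_mul M)
  have h1 : 0 ≤ (y - x) ^ (σ - 1) := Real.rpow_nonneg (by linarith [hx.2]) _
  rw [norm_mul, Real.norm_of_nonneg h1, mul_comm]
  exact mul_le_mul_of_nonneg_right (hf x hx.1.le hx.2) h1

lemma integral_sub_rpow_tail_le {r a δ y : ℝ} (hr : r < -1) (hδ : 0 < δ) (ha : a ≤ y - δ) :
    ∫ x in a..(y - δ), (y - x) ^ r ≤ δ ^ (r + 1) / (-(r + 1)) := by
  have h0 : (0 : ℝ) ∉ uIcc δ (y - a) := by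
    rw [uIcc_of_le (by linarith)]
    exact fun h => absurd h.1 (by linarith)
  rw [intervalIntegral.integral_comp_sub_left (fun x => x ^ r), sub_sub_cancel,
    integral_rpow (Or.inr ⟨by linarith, h0⟩), ← neg_div_neg_eq]
  have : 0 ≤ (y - a) ^ (r + 1) := Real.rpow_nonneg (by linarith) _
  gcongr <;> linarith

lemma intervalIntegrable_sub_rpow_of_lt {r a δ y : ℝ} (hδ : 0 < δ) (ha : a ≤ y - δ) :
    IntervalIntegrable (fun x => (y - x) ^ r) volume a (y - δ) := by
  apply ContinuousOn.intervalIntegrable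
  rw [uIcc_of_le ha]
  intro x hx
  exact ((continuousAt_const.sub continuousAt_id).rpow_const
    (Or.inl (by simpa using (by linarith [hx.2] : y - x ≠ 0)))).continuousWithinAt

lemma hasDerivAt_sub_rpow {r x y : ℝ} (h : x < y) :
    HasDerivAt (fun x => (y - x) ^ r) (-r * (y - x) ^ (r - 1)) x := by
  have := ((hasDerivAt_id x).const_sub y).rpow_const (p := r) (Or.inl (by simp; linarith))
  refine this.congr_deriv ?_
  simp

/-- Splitting a fractional integral into the part close to the singularity, estimated by the
size of `f`, and the part away from it, estimated by the size of an antiderivative `F`. -/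
lemma abs_polyFracInt_le {σ δ ε y M₀ M₁ M₂ : ℝ} (f F : Polynomial ℝ) (hF : F.derivative = f)
    (hF1 : F.eval (-1) = 0) (hσ : 0 < σ) (hσ1 : σ < 1) (hδ : 0 < δ) (hy : -1 ≤ y)
    (hε : ε < 1 - σ) (hM₀ : 0 ≤ M₀) (hM₁ : 0 ≤ M₁) (hM₂ : 0 ≤ M₂)
    (h0 : ∀ x, -1 ≤ x → x ≤ y → y - x ≤ δ → |f.eval x| ≤ M₀)
    (h1 : ∀ x, -1 ≤ x → δ ≤ y - x → |F.eval x| ≤ M₁ + M₂ * (y - x) ^ ε) :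
    |polyFracInt σ f y| ≤ M₀ * (δ ^ σ / σ) + 2 * (M₁ * δ ^ (σ - 1)) +
      (1 + (1 - σ) / (1 - σ - ε)) * (M₂ * δ ^ (σ - 1 + ε)) := by
  have hp1 : 0 ≤ δ ^ (σ - 1) := Real.rpow_nonneg hδ.le _
  have hp2 : 0 ≤ δ ^ (σ - 1 + ε) := Real.rpow_nonneg hδ.le _
  have hq : 0 ≤ (1 - σ) / (1 - σ - ε) := div_nonneg (by linarith) (by linarith)
  rcases le_total (y + 1) δ with hyδ | hyδ
  · have h2 := abs_integral_sub_rpow_mul_le hσ hy f (M := M₀)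
      (fun x hx hxy => h0 x hx hxy (by linarith))
    have h3 : (y - -1) ^ σ ≤ δ ^ σ :=
      Real.rpow_le_rpow (by linarith) (by linarith) hσ.le
    have h4 : M₀ * ((y - -1) ^ σ / σ) ≤ M₀ * (δ ^ σ / σ) := by gcongr
    have : 0 ≤ 2 * (M₁ * δ ^ (σ - 1)) +
      (1 + (1 - σ) / (1 - σ - ε)) * (M₂ * δ ^ (σ - 1 + ε)) := by positivity
    unfold polyFracInt
    linarith
  · have ha : -1 ≤ y - δ := by linarith
    have hint : ∀ a b, IntervalIntegrable (fun x => (y - x) ^ (σ - 1) * f.eval x) volume a b :=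
      fun a b => (intervalIntegrable_sub_rpow (by linarith) y a b).mul_continuousOn
        f.continuous.continuousOn
    have hnear := abs_integral_sub_rpow_mul_le hσ (by linarith : y - δ ≤ y) f (M := M₀)
      (fun x hx hxy => h0 x (by linarith) hxy (by linarith))
    rw [sub_sub_cancel] at hnear
    have hibp : ∫ x in (-1 : ℝ)..(y - δ), (y - x) ^ (σ - 1) * f.eval x =
        δ ^ (σ - 1) * F.eval (y - δ) -
          ∫ x in (-1 : ℝ)..(y - δ), (1 - σ) * ((y - x) ^ (σ - 2) * F.eval x) := by
      have := intervalIntegral.integral_mul_deriv_eq_deriv_mul (a := -1) (b := y - δ)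
        (u := fun x => (y - x) ^ (σ - 1)) (v := fun x => F.eval x)
        (u' := fun x => -(σ - 1) * (y - x) ^ (σ - 1 - 1)) (v' := fun x => F.derivative.eval x)
        (fun x hx => by
          rw [uIcc_of_le ha] at hx
          exact hasDerivAt_sub_rpow (by linarith [hx.2]))
        (fun x _ => F.hasDerivAt x)
        ((intervalIntegrable_sub_rpow_of_lt hδ ha).const_mul _)
        (F.derivative.continuous.intervalIntegrable _ _)
      rw [hF, hF1, sub_sub_cancel, mul_zero, sub_zero] at this
      rw [this]
      congr 1
      apply intervalIntegral.integral_congr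
      intro x _
      simp only
      rw [show σ - 1 - 1 = σ - 2 by ring]
      ring
    have hbdry : |δ ^ (σ - 1) * F.eval (y - δ)| ≤ M₁ * δ ^ (σ - 1) + M₂ * δ ^ (σ - 1 + ε) := by
      have := h1 (y - δ) ha (by linarith)
      rw [sub_sub_cancel] at this
      rw [abs_mul, abs_of_nonneg hp1]
      calc δ ^ (σ - 1) * |F.eval (y - δ)| ≤ δ ^ (σ - 1) * (M₁ + M₂ * δ ^ ε) := by gcongr
        _ = _ := by rw [Real.rpow_add hδ (σ - 1) ε]; ring
    have hfar : |∫ x in (-1 : ℝ)..(y - δ), (1 - σ) * ((y - x) ^ (σ - 2) * F.eval x)| ≤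
        M₁ * δ ^ (σ - 1) + (1 - σ) / (1 - σ - ε) * (M₂ * δ ^ (σ - 1 + ε)) := by
      have hi1 := (intervalIntegrable_sub_rpow_of_lt (r := σ - 2) hδ ha).const_mul ((1 - σ) * M₁)
      have hi2 := (intervalIntegrable_sub_rpow_of_lt (r := σ - 2 + ε) hδ ha).const_mul
        ((1 - σ) * M₂)
      have hle : |∫ x in (-1 : ℝ)..(y - δ), (1 - σ) * ((y - x) ^ (σ - 2) * F.eval x)| ≤
          ∫ x in (-1 : ℝ)..(y - δ), ((1 - σ) * M₁ * (y - x) ^ (σ - 2) +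
            (1 - σ) * M₂ * (y - x) ^ (σ - 2 + ε)) := by
        rw [← Real.norm_eq_abs]
        refine intervalIntegral.norm_integral_le_of_norm_le ha (ae_of_all _ fun x hx => ?_)
          (hi1.add hi2)
        have hyx : 0 < y - x := by linarith [hx.2]
        have h3 := h1 x hx.1.le (by linarith [hx.2])
        have hr : 0 ≤ (y - x) ^ (σ - 2) := Real.rpow_nonneg hyx.le _
        rw [norm_mul, norm_mul, Real.norm_of_nonneg hr, Real.norm_of_nonneg (by linarith),
          Real.norm_eq_abs]
        calc (1 - σ) * ((y - x) ^ (σ - 2) * |F.eval x|) ≤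
            (1 - σ) * ((y - x) ^ (σ - 2) * (M₁ + M₂ * (y - x) ^ ε)) := by
              gcongr
          _ = _ := by rw [Real.rpow_add hyx]; ring
      refine hle.trans ?_
      rw [intervalIntegral.integral_add hi1 hi2, intervalIntegral.integral_const_mul,
        intervalIntegral.integral_const_mul]
      have t1 := integral_sub_rpow_tail_le (r := σ - 2) (by linarith) hδ ha
      have t2 := integral_sub_rpow_tail_le (r := σ - 2 + ε) (by linarith) hδ ha
      rw [show σ - 2 + 1 = σ - 1 by ring, show -(σ - 1) = 1 - σ by ring] at t1
      rw [show σ - 2 + ε + 1 = σ - 1 + ε by ring, show -(σ - 1 + ε) = 1 - σ - ε by ring] at t2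
      have hσ' : 0 < 1 - σ := by linarith
      have hσ'' : 0 < 1 - σ - ε := by linarith
      calc _ ≤ (1 - σ) * M₁ * (δ ^ (σ - 1) / (1 - σ)) +
            (1 - σ) * M₂ * (δ ^ (σ - 1 + ε) / (1 - σ - ε)) := by gcongr
        _ = _ := by field_simp
    rw [polyFracInt, ← intervalIntegral.integral_add_adjacent_intervals (hint (-1) (y - δ))
      (hint (y - δ) y), hibp]
    refine (abs_add_le _ _).trans ?_
    have := abs_sub (δ ^ (σ - 1) * F.eval (y - δ))
      (∫ x in (-1 : ℝ)..(y - δ), (1 - σ) * ((y - x) ^ (σ - 2) * F.eval x))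
    linarith

lemma integral_sub_rpow_mul_derivative {s y : ℝ} (F : Polynomial ℝ) (hs : 0 < s) (hy : -1 ≤ y) :
    ∫ x in (-1 : ℝ)..y, (y - x) ^ s * F.derivative.eval x =
      s * polyFracInt s F y - (y + 1) ^ s * F.eval (-1) := by
  have := intervalIntegral.integral_mul_deriv_eq_deriv_mul_of_hasDerivAt (a := -1) (b := y)
    (u := fun x => (y - x) ^ s) (v := fun x => F.eval x)
    (u' := fun x => -s * (y - x) ^ (s - 1)) (v' := fun x => F.derivative.eval x)
    (((continuous_const.sub continuous_id).rpow_const fun _ => Or.inr hs.le).continuousOn)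
    F.continuous.continuousOn
    (fun x hx => by
      rw [min_eq_left hy, max_eq_right hy] at hx
      exact hasDerivAt_sub_rpow hx.2)
    (fun x _ => F.hasDerivAt x)
    ((intervalIntegrable_sub_rpow (by linarith) _ _ _).const_mul _)
    (F.derivative.continuous.intervalIntegrable _ _)
  rw [this, polyFracInt, ← intervalIntegral.integral_const_mul, sub_self, Real.zero_rpow hs.ne',
    zero_mul, zero_sub, sub_neg_eq_add, ← sub_eq_zero]
  simp only [neg_mul, intervalIntegral.integral_neg, mul_assoc]
  ring

lemma polyFracInt_eq_mul {s y : ℝ} (f F : Polynomial ℝ) (hF : F.derivative = f)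
    (hF1 : F.eval (-1) = 0) (hs : 1 < s) (hy : -1 ≤ y) :
    polyFracInt s f y = (s - 1) * polyFracInt (s - 1) F y := by
  rw [polyFracInt, ← hF, integral_sub_rpow_mul_derivative F (by linarith) hy, hF1, mul_zero,
    sub_zero]

lemma rpow_quarter_pow_four {a : ℝ} (ha : 0 ≤ a) (e : ℝ) : (a ^ (e / 4)) ^ 4 = a ^ e := by
  rw [← Real.rpow_natCast, ← Real.rpow_mul ha]
  norm_num

/-- The bound for `legendreP (n + 1)` in the regularised weight `η`. -/
lemma abs_legendreP_le_of_weight (n : ℕ) {x η : ℝ} (hx : x ∈ Icc (-1 : ℝ) 1) (hη : 0 < η)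
    (h : η ≤ 2 * (1 - x ^ 2) ∨ η ≤ 1 / (n + 1 : ℝ) ^ 2) :
    |(legendreP (n + 1)).eval x| ≤ 2 * (n + 1 : ℝ) ^ (-(1 / 2) : ℝ) * η ^ (-(1 / 4) : ℝ) := by
  set p : ℝ := n + 1 with hp
  have hp0 : 0 < p := by positivity
  have hx2 : 0 ≤ 1 - x ^ 2 := by nlinarith [hx.1, hx.2]
  have hrhs : (2 * p ^ (-(1 / 2) : ℝ) * η ^ (-(1 / 4) : ℝ)) ^ 4 = 16 / (p ^ 2 * η) := by
    have h1 := rpow_quarter_pow_four hp0.le (-2)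
    have h2 := rpow_quarter_pow_four hη.le (-1)
    rw [mul_pow, mul_pow, show (-(1 / 2) : ℝ) = -2 / 4 by norm_num, h1,
      show (-(1 / 4) : ℝ) = -1 / 4 by norm_num, h2, Real.rpow_neg hp0.le, Real.rpow_neg hη.le,
      Real.rpow_one]
    norm_num
    field_simp
  refine le_of_pow_le_pow_left₀ (n := 4) (by norm_num) (by positivity) ?_
  rw [hrhs, le_div_iff₀ (by positivity)]
  rcases h with h | h
  · have hB := legendreP_sq_mul_sqrt_le n hx
    rw [← hp, le_div_iff₀ hp0] at hB
    have h4 : (√(1 - x ^ 2) * (legendreP (n + 1)).eval x ^ 2 * p) ^ 2 ≤ 2 ^ 2 := by gcongr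
    rw [mul_pow, mul_pow, Real.sq_sqrt hx2] at h4
    have : |(legendreP (n + 1)).eval x| ^ 4 = (legendreP (n + 1)).eval x ^ 4 := by
      rw [show 4 = 2 * 2 by rfl, pow_mul, pow_mul, sq_abs]
    rw [this]
    calc (legendreP (n + 1)).eval x ^ 4 * (p ^ 2 * η) ≤
        (legendreP (n + 1)).eval x ^ 4 * (p ^ 2 * (2 * (1 - x ^ 2))) := by gcongr
      _ ≤ 16 := by nlinarith
  · have h1 := abs_legendreP_le_one n hx
    have h2 : p ^ 2 * η ≤ 1 := by
      rw [le_div_iff₀ (by positivity)] at h; linarith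
    have h3 : |(legendreP (n + 1)).eval x| ^ 4 ≤ 1 := pow_le_one₀ (abs_nonneg _) h1
    have : |(legendreP (n + 1)).eval x| ^ 4 * (p ^ 2 * η) ≤ 1 * 1 := by gcongr
    linarith

lemma abs_legendrePrim_le_of_weight (n : ℕ) {x : ℝ} (hx : x ∈ Icc (-1 : ℝ) 1) :
    |(legendrePrim n).eval x| ≤ 4 * (n + 1 : ℝ) ^ (-(3 / 2) : ℝ) * (1 - x ^ 2) ^ (1 / 4 : ℝ) := by
  set p : ℝ := n + 1 with hp
  have hp0 : 0 < p := by positivity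
  have hx2 : 0 ≤ 1 - x ^ 2 := by nlinarith [hx.1, hx.2]
  refine le_of_pow_le_pow_left₀ (n := 4) (by norm_num) (by positivity) ?_
  have h1 := rpow_quarter_pow_four hp0.le (-6)
  have h2 := rpow_quarter_pow_four hx2 1
  rw [mul_pow, mul_pow, show (-(3 / 2) : ℝ) = -6 / 4 by norm_num, h1, h2, Real.rpow_one,
    Real.rpow_neg hp0.le]
  have hB := legendrePrim_sq_le n hx
  have h4 : ((legendrePrim n).eval x ^ 2) ^ 2 ≤ (11 * √(1 - x ^ 2) / (n + 1) ^ 3) ^ 2 := by gcongr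
  rw [div_pow, mul_pow, Real.sq_sqrt hx2, ← hp] at h4
  have : |(legendrePrim n).eval x| ^ 4 = ((legendrePrim n).eval x ^ 2) ^ 2 := by
    rw [show 4 = 2 * 2 by rfl, pow_mul, sq_abs]
  rw [this]
  refine h4.trans ?_
  have e : p ^ (6 : ℝ) = p ^ 6 := by exact_mod_cast Real.rpow_natCast p 6
  rw [e, ← pow_mul, ← div_eq_mul_inv, div_mul_eq_mul_div]
  gcongr
  norm_num

lemma abs_legendrePrim_le (n : ℕ) {x : ℝ} (hx : x ∈ Icc (-1 : ℝ) 1) :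
    |(legendrePrim n).eval x| ≤ 4 * (n + 1 : ℝ) ^ (-(3 / 2) : ℝ) := by
  refine (abs_legendrePrim_le_of_weight n hx).trans (mul_le_of_le_one_right (by positivity) ?_)
  exact Real.rpow_le_one (by nlinarith [hx.1, hx.2]) (by nlinarith) (by norm_num)

lemma abs_polyFracInt_legendreP_le_of_lt_one {σ : ℝ} (hσ : 0 < σ) (hσ1 : σ < 1) :
    ∃ C > 0, ∀ n : ℕ, ∀ y ∈ Icc (-1 : ℝ) 1,
      |polyFracInt σ (legendreP (n + 1)) y| ≤ C * (n + 1 : ℝ) ^ (-(min (2 * σ) (σ + 1 / 2))) := by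
  obtain ⟨ε, hε⟩ : ∃ ε, ε = min (1 / 4) ((1 - σ) / 2) := ⟨_, rfl⟩
  have hε0 : 0 < ε := by rw [hε]; apply lt_min <;> linarith
  have hε4 : ε ≤ 1 / 4 := hε ▸ min_le_left _ _
  have hε1 : ε < 1 - σ := by
    have : ε ≤ (1 - σ) / 2 := hε ▸ min_le_right _ _
    linarith
  have hK : 0 < (1 - σ) / (1 - σ - ε) := div_pos (by linarith) (by linarith)
  refine ⟨2 / σ + 32 + (1 + (1 - σ) / (1 - σ - ε)) * 64, by positivity, fun n y hy => ?_⟩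
  set p : ℝ := n + 1 with hp
  have hp1 : 1 ≤ p := by rw [hp]; linarith [n.cast_nonneg (α := ℝ)]
  have hp0 : 0 < p := by linarith
  set μ := min (2 * σ) (σ + 1 / 2) with hμ
  obtain ⟨η, hη⟩ : ∃ η, η = max (1 - y ^ 2) (1 / p ^ 2) := ⟨_, rfl⟩
  have hηp : 1 / p ^ 2 ≤ η := hη ▸ le_max_right _ _
  have hηy : 1 - y ^ 2 ≤ η := hη ▸ le_max_left _ _
  have hη0 : 0 < η := lt_of_lt_of_le (by positivity) hηp
  have hη1 : η ≤ 1 := by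
    rw [hη]
    refine max_le (by nlinarith) ?_
    rw [div_le_one (by positivity)]; nlinarith
  have hηp' : p ^ (-2 : ℝ) ≤ η := by
    rw [Real.rpow_neg hp0.le, Real.rpow_two]; simpa using hηp
  set δ := η ^ (1 / 2 : ℝ) * p ^ (-1 : ℝ) * 4⁻¹ with hδ
  have hδ0 : 0 < δ := by positivity
  have hδη : δ ≤ η / 4 := by
    have h1 : p ^ (-1 : ℝ) ≤ η ^ (1 / 2 : ℝ) := by
      have := Real.rpow_le_rpow (by positivity) hηp' (by norm_num : (0 : ℝ) ≤ 1 / 2)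
      rwa [← Real.rpow_mul hp0.le, show (-2 : ℝ) * (1 / 2) = -1 by norm_num] at this
    have h2 : η ^ (1 / 2 : ℝ) * η ^ (1 / 2 : ℝ) = η := by
      rw [← Real.rpow_add hη0]; norm_num
    have : η ^ (1 / 2 : ℝ) * p ^ (-1 : ℝ) ≤ η ^ (1 / 2 : ℝ) * η ^ (1 / 2 : ℝ) := by gcongr
    rw [hδ]; linarith
  have hδp : p ^ (-2 : ℝ) * 4⁻¹ ≤ δ := by
    have h1 : p ^ (-1 : ℝ) ≤ η ^ (1 / 2 : ℝ) := by
      have := Real.rpow_le_rpow (by positivity) hηp' (by norm_num : (0 : ℝ) ≤ 1 / 2)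
      rwa [← Real.rpow_mul hp0.le, show (-2 : ℝ) * (1 / 2) = -1 by norm_num] at this
    have h2 : p ^ (-1 : ℝ) * p ^ (-1 : ℝ) = p ^ (-2 : ℝ) := by
      rw [← Real.rpow_add hp0]; norm_num
    rw [hδ, ← h2]; gcongr
  have hmain := abs_polyFracInt_le (legendreP (n + 1)) (legendrePrim n) (derivative_legendrePrim n)
    (legendrePrim_eval_neg_one n) hσ hσ1 hδ0 hy.1 hε1
    (M₀ := 2 * p ^ (-(1 / 2) : ℝ) * η ^ (-(1 / 4) : ℝ))
    (M₁ := 4 * p ^ (-(3 / 2) : ℝ) * η ^ (1 / 4 : ℝ)) (M₂ := 16 * p ^ (-(3 / 2) : ℝ))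
    (by positivity) (by positivity) (by positivity)
    (by
      intro x hx hxy hxδ
      refine abs_legendreP_le_of_weight n ⟨hx, hxy.trans hy.2⟩ hη0 ?_
      rcases max_choice (1 - y ^ 2) (1 / p ^ 2) with h | h
      · left
        rw [← hη] at h
        nlinarith [hy.1, hy.2]
      · right
        rw [← hη] at h
        exact h.le)
    (by
      intro x hx hxδ
      have hxy : x ≤ y := by linarith
      have hx1 : x ∈ Icc (-1 : ℝ) 1 := ⟨hx, hxy.trans hy.2⟩
      refine (abs_legendrePrim_le_of_weight n hx1).trans ?_
      have hx2 : 0 ≤ 1 - x ^ 2 := by nlinarith [hx1.1, hx1.2]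
      have ht : 0 < y - x := by linarith
      have h1 : 1 - x ^ 2 ≤ η + 2 * (y - x) := by nlinarith [hy.2, hx1.2]
      have h2 : (1 - x ^ 2) ^ (1 / 4 : ℝ) ≤ η ^ (1 / 4 : ℝ) + (2 * (y - x)) ^ (1 / 4 : ℝ) :=
        (Real.rpow_le_rpow hx2 h1 (by norm_num)).trans
          (Real.rpow_add_le_add_rpow hη0.le (by linarith) (by norm_num) (by norm_num))
      have h3 : (2 * (y - x)) ^ (1 / 4 : ℝ) ≤ 4 * (y - x) ^ ε := by
        have h4 : (2 * (y - x)) = 4 * ((y - x) / 2) := by ring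
        have h5 : ((y - x) / 2) ^ (1 / 4 : ℝ) ≤ ((y - x) / 2) ^ ε :=
          Real.rpow_le_rpow_of_exponent_ge (by linarith) (by linarith [hy.2]) hε4
        have h6 : ((y - x) / 2) ^ ε ≤ (y - x) ^ ε :=
          Real.rpow_le_rpow (by linarith) (by linarith) hε0.le
        have h7 : (4 : ℝ) ^ (1 / 4 : ℝ) ≤ 4 ^ (1 : ℝ) :=
          Real.rpow_le_rpow_of_exponent_le (by norm_num) (by norm_num)
        rw [Real.rpow_one] at h7
        rw [h4, Real.mul_rpow (by norm_num) (by linarith)]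
        exact mul_le_mul h7 (h5.trans h6) (by positivity) (by norm_num)
      calc 4 * p ^ (-(3 / 2) : ℝ) * (1 - x ^ 2) ^ (1 / 4 : ℝ) ≤
          4 * p ^ (-(3 / 2) : ℝ) * (η ^ (1 / 4 : ℝ) + 4 * (y - x) ^ ε) := by
            gcongr; linarith
        _ = _ := by ring)
  have hbase : p ^ (-(1 / 2) - σ : ℝ) * η ^ (σ / 2 - 1 / 4) ≤ p ^ (-μ) := by
    rcases le_total (1 / 2) σ with h | h
    · have h1 : η ^ (σ / 2 - 1 / 4) ≤ 1 := Real.rpow_le_one hη0.le hη1 (by linarith)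
      have h2 : p ^ (-(1 / 2) - σ : ℝ) ≤ p ^ (-μ) := by
        apply Real.rpow_le_rpow_of_exponent_le hp1
        have := min_le_right (2 * σ) (σ + 1 / 2)
        linarith
      exact (mul_le_of_le_one_right (by positivity) h1).trans h2
    · have h1 : η ^ (σ / 2 - 1 / 4) ≤ (p ^ (-2 : ℝ)) ^ (σ / 2 - 1 / 4) :=
        Real.rpow_le_rpow_of_nonpos (by positivity) hηp' (by linarith)
      rw [← Real.rpow_mul hp0.le] at h1
      calc _ ≤ p ^ (-(1 / 2) - σ : ℝ) * p ^ (-2 * (σ / 2 - 1 / 4)) := by gcongr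
        _ = p ^ (-(2 * σ)) := by rw [← Real.rpow_add hp0]; congr 1; ring
        _ ≤ _ := by
          apply Real.rpow_le_rpow_of_exponent_le hp1
          have := min_le_left (2 * σ) (σ + 1 / 2)
          linarith
  have hδpow : ∀ e : ℝ, δ ^ e = η ^ (e / 2) * p ^ (-e) * 4 ^ (-e) := by
    intro e
    rw [hδ, Real.mul_rpow (by positivity) (by positivity),
      Real.mul_rpow (by positivity) (by positivity), ← Real.rpow_mul hη0.le,
      ← Real.rpow_mul hp0.le, Real.inv_rpow (by norm_num), ← Real.rpow_neg (by norm_num)]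
    congr 3 <;> ring
  have t0 : 2 * p ^ (-(1 / 2) : ℝ) * η ^ (-(1 / 4) : ℝ) * (δ ^ σ / σ) ≤ 2 / σ * p ^ (-μ) := by
    have h4 : (4 : ℝ) ^ (-σ) ≤ 1 := Real.rpow_le_one_of_one_le_of_nonpos (by norm_num) (by linarith)
    calc _ = 2 / σ * (p ^ (-(1 / 2) - σ : ℝ) * η ^ (σ / 2 - 1 / 4)) * 4 ^ (-σ) := by
          rw [hδpow, show (-(1 / 2) - σ : ℝ) = -(1 / 2) + -σ by ring, Real.rpow_add hp0,
            show σ / 2 - 1 / 4 = σ / 2 + -(1 / 4) by ring, Real.rpow_add hη0]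
          ring
      _ ≤ 2 / σ * p ^ (-μ) * 1 := by gcongr
      _ = _ := mul_one _
  have t1 : 4 * p ^ (-(3 / 2) : ℝ) * η ^ (1 / 4 : ℝ) * δ ^ (σ - 1) ≤ 16 * p ^ (-μ) := by
    have h4 : (4 : ℝ) ^ (-(σ - 1)) ≤ 4 ^ (1 : ℝ) :=
      Real.rpow_le_rpow_of_exponent_le (by norm_num) (by linarith)
    rw [Real.rpow_one] at h4
    calc _ = 4 * (p ^ (-(1 / 2) - σ : ℝ) * η ^ (σ / 2 - 1 / 4)) * 4 ^ (-(σ - 1)) := by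
          rw [hδpow, show (-(1 / 2) - σ : ℝ) = -(3 / 2) + -(σ - 1) by ring, Real.rpow_add hp0,
            show σ / 2 - 1 / 4 = (σ - 1) / 2 + 1 / 4 by ring, Real.rpow_add hη0]
          ring
      _ ≤ 4 * p ^ (-μ) * 4 := by gcongr
      _ = _ := by ring
  have t2 : 16 * p ^ (-(3 / 2) : ℝ) * δ ^ (σ - 1 + ε) ≤ 64 * p ^ (-μ) := by
    have h1 : δ ^ (σ - 1 + ε) ≤ (p ^ (-2 : ℝ) * 4⁻¹) ^ (σ - 1 + ε) :=
      Real.rpow_le_rpow_of_nonpos (by positivity) hδp (by linarith)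
    rw [Real.mul_rpow (x := p ^ (-2 : ℝ)) (y := 4⁻¹) (by positivity) (by positivity),
      ← Real.rpow_mul hp0.le, Real.inv_rpow (by norm_num), ← Real.rpow_neg (by norm_num)] at h1
    have h4 : (4 : ℝ) ^ (-(σ - 1 + ε)) ≤ 4 ^ (1 : ℝ) :=
      Real.rpow_le_rpow_of_exponent_le (by norm_num) (by linarith)
    rw [Real.rpow_one] at h4
    calc _ ≤ 16 * p ^ (-(3 / 2) : ℝ) * (p ^ (-2 * (σ - 1 + ε)) * 4) := by
          refine mul_le_mul_of_nonneg_left (h1.trans ?_) (by positivity)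
          gcongr
      _ = 64 * p ^ (-(3 / 2) + -2 * (σ - 1 + ε)) := by rw [Real.rpow_add hp0]; ring
      _ ≤ _ := by
        gcongr
        rcases min_choice (1 / 4) ((1 - σ) / 2) with h | h
        · rw [h] at hε
          have := min_le_left (2 * σ) (σ + 1 / 2)
          linarith
        · rw [h] at hε
          have := min_le_right (2 * σ) (σ + 1 / 2)
          linarith
  refine hmain.trans ?_
  have := mul_le_mul_of_nonneg_left t2 (by positivity : 0 ≤ 1 + (1 - σ) / (1 - σ - ε))
  linarith

/-- A second antiderivative of `legendreP (n + 2)`, vanishing at `-1`. -/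
noncomputable def legendrePrim₂ (n : ℕ) : Polynomial ℝ :=
  Polynomial.C (1 / (2 * n + 5 : ℝ)) * (legendrePrim (n + 2) - legendrePrim n)

lemma derivative_legendrePrim₂ (n : ℕ) : (legendrePrim₂ n).derivative = legendrePrim (n + 1) := by
  rw [legendrePrim₂, Polynomial.derivative_C_mul, Polynomial.derivative_sub,
    derivative_legendrePrim, derivative_legendrePrim, legendrePrim]
  push_cast
  ring_nf

lemma legendrePrim₂_eval_neg_one (n : ℕ) : (legendrePrim₂ n).eval (-1) = 0 := by
  simp [legendrePrim₂, legendrePrim_eval_neg_one]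

lemma rpow_add_one_sub_le (n : ℕ) {e : ℝ} (he : 0 ≤ e) :
    (n + 1 : ℝ) ^ (-e) ≤ 2 ^ e * (n + 2 : ℝ) ^ (-e) := by
  have h : ((n + 2 : ℝ) / 2) ^ e ≤ (n + 1 : ℝ) ^ e :=
    Real.rpow_le_rpow (by positivity) (by linarith [n.cast_nonneg (α := ℝ)]) he
  rw [Real.div_rpow (by positivity) (by norm_num)] at h
  rw [Real.rpow_neg (by positivity), Real.rpow_neg (by positivity), ← div_eq_mul_inv, ← inv_div]
  gcongr

lemma abs_legendrePrim₂_le (n : ℕ) {x : ℝ} (hx : x ∈ Icc (-1 : ℝ) 1) :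
    |(legendrePrim₂ n).eval x| ≤ 4 * (1 + 2 ^ (3 / 2 : ℝ)) * (n + 2 : ℝ) ^ (-(5 / 2) : ℝ) := by
  have h1 := abs_legendrePrim_le n hx
  have h2 := abs_legendrePrim_le (n + 2) hx
  have h3 := rpow_add_one_sub_le n (e := 3 / 2) (by norm_num)
  push_cast at h2
  have h4 : (n + 2 + 1 : ℝ) ^ (-(3 / 2) : ℝ) ≤ (n + 2 : ℝ) ^ (-(3 / 2) : ℝ) :=
    Real.rpow_le_rpow_of_nonpos (by positivity) (by linarith) (by norm_num)
  have h5 : 1 / (2 * n + 5 : ℝ) ≤ (n + 2 : ℝ) ^ (-1 : ℝ) := by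
    rw [Real.rpow_neg_one, ← one_div]
    exact one_div_le_one_div_of_le (by positivity) (by linarith [n.cast_nonneg (α := ℝ)])
  have h6 : (n + 2 : ℝ) ^ (-(5 / 2) : ℝ) = (n + 2 : ℝ) ^ (-1 : ℝ) * (n + 2 : ℝ) ^ (-(3 / 2) : ℝ) := by
    rw [← Real.rpow_add (by positivity)]; norm_num
  rw [legendrePrim₂, Polynomial.eval_mul, Polynomial.eval_C, Polynomial.eval_sub, abs_mul,
    abs_of_nonneg (by positivity), h6]
  have h7 := abs_sub ((legendrePrim (n + 2)).eval x) ((legendrePrim n).eval x)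
  calc _ ≤ (n + 2 : ℝ) ^ (-1 : ℝ) * (4 * (1 + 2 ^ (3 / 2 : ℝ)) * (n + 2 : ℝ) ^ (-(3 / 2) : ℝ)) := by
        gcongr
        linarith
    _ = _ := by ring

lemma abs_polyFracInt_legendreP_le_of_one_lt {σ : ℝ} (hσ : 0 < σ) (hσ1 : σ < 1) :
    ∃ C > 0, ∀ n : ℕ, ∀ y ∈ Icc (-1 : ℝ) 1,
      |polyFracInt (σ + 1) (legendreP (n + 2)) y| ≤ C * (n + 2 : ℝ) ^ (-(σ + 3 / 2)) := by
  refine ⟨σ * (4 / σ + 8 * (1 + 2 ^ (3 / 2 : ℝ))), by positivity, fun n y hy => ?_⟩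
  rw [polyFracInt_eq_mul _ (legendrePrim (n + 1)) (derivative_legendrePrim (n + 1))
    (legendrePrim_eval_neg_one _) (by linarith) hy.1, add_sub_cancel_right, abs_mul,
    abs_of_pos hσ, mul_assoc]
  gcongr
  set p : ℝ := n + 2 with hp
  have hp0 : 0 < p := by positivity
  have hmain := abs_polyFracInt_le (y := y) (legendrePrim (n + 1)) (legendrePrim₂ n)
    (derivative_legendrePrim₂ n) (legendrePrim₂_eval_neg_one n) hσ hσ1
    (δ := p ^ (-1 : ℝ)) (ε := 0) (by positivity) hy.1 (by linarith)
    (M₀ := 4 * p ^ (-(3 / 2) : ℝ)) (M₁ := 4 * (1 + 2 ^ (3 / 2 : ℝ)) * p ^ (-(5 / 2) : ℝ))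
    (M₂ := 0) (by positivity) (by positivity) le_rfl
    (by
      intro x hx hxy _
      have := abs_legendrePrim_le (n + 1) (x := x) ⟨hx, hxy.trans hy.2⟩
      push_cast at this
      rwa [show (n + 1 + 1 : ℝ) = p by rw [hp]; ring] at this)
    (by
      intro x hx hxδ
      have hδ : 0 < p ^ (-1 : ℝ) := by positivity
      rw [zero_mul, add_zero]
      exact abs_legendrePrim₂_le n ⟨hx, by linarith [hy.2]⟩)
  refine hmain.trans (le_of_eq ?_)
  rw [← Real.rpow_mul hp0.le, ← Real.rpow_mul hp0.le,
    show -(σ + 3 / 2) = -(3 / 2) + -1 * σ by ring, Real.rpow_add hp0,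
    show (-(5 / 2) : ℝ) = -(3 / 2) + -1 by norm_num, Real.rpow_add hp0,
    show -1 * (σ - 1) = -(-1) + -1 * σ by ring, Real.rpow_add hp0, Real.rpow_neg hp0.le (-1)]
  have : p ^ (-1 : ℝ) ≠ 0 := by positivity
  field_simp
  ring

lemma polyFracInt_sub {s y : ℝ} (hs : 0 < s) (c : ℝ) (f g : Polynomial ℝ) :
    polyFracInt s (Polynomial.C c * (f - g)) y = c * (polyFracInt s f y - polyFracInt s g y) := by
  have hi : ∀ h : Polynomial ℝ,
      IntervalIntegrable (fun x => (y - x) ^ (s - 1) * h.eval x) volume (-1) y := fun h =>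
    (intervalIntegrable_sub_rpow (by linarith) y _ _).mul_continuousOn h.continuous.continuousOn
  rw [polyFracInt, polyFracInt, polyFracInt, ← intervalIntegral.integral_sub (hi f) (hi g),
    ← intervalIntegral.integral_const_mul]
  congr 1
  ext x
  simp
  ring

lemma abs_polyFracInt_legendreP_le_of_nat (j : ℕ) {σ : ℝ} (hσ : 0 < σ) (hσ1 : σ < 1) :
    ∃ C > 0, ∀ n : ℕ, ∀ y ∈ Icc (-1 : ℝ) 1,
      |polyFracInt (σ + (j + 1)) (legendreP (n + j + 2)) y| ≤
        C * (n + j + 2 : ℝ) ^ (-(σ + (j + 1) + 1 / 2)) := by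
  induction j with
  | zero =>
    obtain ⟨C, hC, h⟩ := abs_polyFracInt_legendreP_le_of_one_lt hσ hσ1
    refine ⟨C, hC, fun n y hy => ?_⟩
    have := h n y hy
    simp only [Nat.cast_zero, zero_add, add_zero]
    rwa [show σ + 1 + 1 / 2 = σ + 3 / 2 by ring]
  | succ j ih =>
    obtain ⟨C, hC, h⟩ := ih
    set s : ℝ := σ + (j + 1) with hs
    have hs1 : 1 < s := by rw [hs]; linarith [j.cast_nonneg (α := ℝ)]
    refine ⟨s * (C * (1 + 2 ^ (s + 1 / 2))), by positivity, fun n y hy => ?_⟩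
    have es : σ + (((j + 1 : ℕ) : ℝ) + 1) = s + 1 := by rw [hs]; push_cast; ring
    have ei : n + (j + 1) + 2 = (n + j + 2) + 1 := by ring
    rw [es, ei, polyFracInt_eq_mul _ (legendrePrim (n + j + 2)) (derivative_legendrePrim _)
      (legendrePrim_eval_neg_one _) (by linarith) hy.1, add_sub_cancel_right, legendrePrim,
      polyFracInt_sub (by linarith), abs_mul, abs_of_pos (by linarith : 0 < s), mul_assoc]
    gcongr
    have h1 := h n y hy
    have h2 := h (n + 2) y hy
    rw [show n + 2 + j + 2 = n + j + 2 + 2 by ring] at h2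
    push_cast at h2
    set p : ℝ := n + j + 3 with hp
    have hp0 : 0 < p := by positivity
    have h3 := rpow_add_one_sub_le (n + j + 1) (e := s + 1 / 2) (by linarith)
    push_cast at h3
    rw [show (n + j + 1 + 1 : ℝ) = n + j + 2 by ring, show (n + j + 1 + 2 : ℝ) = p by rw [hp]; ring]
      at h3
    have h4 : (n + 2 + j + 2 : ℝ) ^ (-(s + 1 / 2)) ≤ p ^ (-(s + 1 / 2)) :=
      Real.rpow_le_rpow_of_nonpos hp0 (by rw [hp]; linarith) (by linarith)
    push_cast
    have h5 : 1 / (2 * (n + j + 2) + 3 : ℝ) ≤ p ^ (-1 : ℝ) := by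
      rw [Real.rpow_neg_one, ← one_div]
      exact one_div_le_one_div_of_le (by positivity)
        (by rw [hp]; linarith [n.cast_nonneg (α := ℝ), j.cast_nonneg (α := ℝ)])
    have h7 := abs_sub (polyFracInt s (legendreP (n + j + 2 + 2)) y)
      (polyFracInt s (legendreP (n + j + 2)) y)
    rw [abs_mul, abs_of_nonneg (by positivity)]
    calc _ ≤ p ^ (-1 : ℝ) * (C * (1 + 2 ^ (s + 1 / 2)) * p ^ (-(s + 1 / 2))) := by
          gcongr
          calc _ ≤ _ := h7
            _ ≤ C * p ^ (-(s + 1 / 2)) + C * (2 ^ (s + 1 / 2) * p ^ (-(s + 1 / 2))) := by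
              refine add_le_add (h2.trans ?_) (h1.trans ?_) <;> gcongr
            _ = _ := by ring
      _ = C * (1 + 2 ^ (s + 1 / 2)) * (p ^ (-1 : ℝ) * p ^ (-(s + 1 / 2))) := by ring
      _ = _ := by
        rw [← Real.rpow_add hp0, hp]
        congr 2 <;> ring

/-- The uniform bound on fractional integrals of Legendre polynomials of non-integral order. -/
lemma abs_polyFracInt_legendreP_le {s : ℝ} (hs : 0 < s) (hsint : ∀ j : ℤ, s ≠ j) :
    ∃ C > 0, ∀ p : ℕ, s < p → ∀ y ∈ Icc (-1 : ℝ) 1,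
      |polyFracInt s (legendreP p) y| ≤ C * (p : ℝ) ^ (-(min (2 * s) (s + 1 / 2))) := by
  have hfl : 0 < Int.fract s := Int.fract_pos.2 (hsint _)
  have hfl1 := Int.fract_lt_one s
  have hfloor : (⌊s⌋₊ : ℝ) + Int.fract s = s := by
    rw [natCast_floor_eq_intCast_floor hs.le]; exact Int.floor_add_fract s
  rcases Nat.eq_zero_or_pos ⌊s⌋₊ with h0 | h0
  · rw [h0, Nat.cast_zero, zero_add] at hfloor
    obtain ⟨C, hC, h⟩ := abs_polyFracInt_legendreP_le_of_lt_one hfl hfl1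
    rw [hfloor] at h
    refine ⟨C, hC, fun p hp y hy => ?_⟩
    obtain ⟨n, rfl⟩ : ∃ n, p = n + 1 := ⟨p - 1, by
      have : 0 < p := by exact_mod_cast hs.trans hp
      omega⟩
    have := h n y hy
    push_cast
    exact this
  · obtain ⟨j, hj⟩ : ∃ j, ⌊s⌋₊ = j + 1 := ⟨⌊s⌋₊ - 1, by omega⟩
    obtain ⟨C, hC, h⟩ := abs_polyFracInt_legendreP_le_of_nat j hfl hfl1
    have es : Int.fract s + (j + 1) = s := by rw [hj] at hfloor; push_cast at hfloor; linarith
    rw [es] at h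
    refine ⟨C, hC, fun p hp y hy => ?_⟩
    have hlt : (j + 1 : ℝ) < p := by linarith
    have hlt' : j + 1 < p := by exact_mod_cast hlt
    obtain ⟨n, rfl⟩ : ∃ n, p = n + j + 2 := ⟨p - (j + 2), by omega⟩
    have hmin : min (2 * s) (s + 1 / 2) = s + 1 / 2 :=
      min_eq_right (by linarith [j.cast_nonneg (α := ℝ)])
    rw [hmin]
    have := h n y hy
    push_cast
    exact this

lemma intervalIntegrable_sub_rpow_mul_eval {r : ℝ} (hr : -1 < r) (y a b : ℝ) (f : Polynomial ℝ) :
    IntervalIntegrable (fun x => (y - x) ^ r * f.eval x) volume a b :=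
  (intervalIntegrable_sub_rpow hr y a b).mul_continuousOn f.continuous.continuousOn

lemma polyFracInt_legendreP_succ_one {s : ℝ} (hs : 0 < s) (n : ℕ) :
    (n + 1 + s) * polyFracInt s (legendreP (n + 1)) 1 =
      (n + 1 - s) * polyFracInt s (legendreP n) 1 := by
  have h := integral_sub_rpow_mul_derivative (y := 1) (legendreP (n + 1) + legendreP n) hs
    (by norm_num)
  have hi : ∀ f : Polynomial ℝ,
      IntervalIntegrable (fun x => (1 - x) ^ (s - 1) * f.eval x) volume (-1) 1 := fun f =>
    intervalIntegrable_sub_rpow_mul_eval (by linarith) _ _ _ _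
  have h1 : ∫ x in (-1 : ℝ)..1, (1 - x) ^ s * (legendreP (n + 1) + legendreP n).derivative.eval x =
      (n + 1) * (polyFracInt s (legendreP n) 1 - polyFracInt s (legendreP (n + 1)) 1) := by
    rw [polyFracInt, polyFracInt, ← intervalIntegral.integral_sub (hi _) (hi _),
      ← intervalIntegral.integral_const_mul]
    refine intervalIntegral.integral_congr fun x hx => ?_
    rw [uIcc_of_le (by norm_num)] at hx
    have e : (1 - x) ^ s = (1 - x) ^ (s - 1) * (1 - x) := by
      rcases eq_or_lt_of_le hx.2 with rfl | hx1
      · simp [Real.zero_rpow hs.ne']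
      · conv_rhs => rw [← Real.rpow_add_one (by linarith), sub_add_cancel]
    obtain ⟨d1, d2⟩ := legendreP_derivative_relations n x
    simp only [Polynomial.derivative_add, Polynomial.eval_add, e]
    linear_combination (1 - x) ^ (s - 1) * (d2 - d1)
  have h2 : polyFracInt s (legendreP (n + 1) + legendreP n) 1 =
      polyFracInt s (legendreP (n + 1)) 1 + polyFracInt s (legendreP n) 1 := by
    simp only [polyFracInt, Polynomial.eval_add, mul_add]
    exact intervalIntegral.integral_add (hi _) (hi _)
  rw [h1, h2, Polynomial.eval_add, legendreP_eval_neg_one, legendreP_eval_neg_one] at h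
  linear_combination -h

lemma sub_div_add_le_rpow {s j : ℝ} (hs : 0 < s) (hj : s ≤ j) :
    (j - s) / (j + s) ≤ (j / (j + 1)) ^ (2 * s) := by
  have hj0 : 0 < j := hs.trans_le hj
  rcases hj.eq_or_lt with rfl | hlt
  · rw [sub_self, zero_div]; positivity
  have ht : |s / j| < 1 := by rw [abs_of_pos (by positivity), div_lt_one hj0]; exact hlt
  have h1 := Real.hasSum_log_sub_log_of_abs_lt_one ht
  have h2 := h1.summable.sum_le_tsum {0} (fun i _ => by positivity)
  rw [h1.tsum_eq] at h2
  simp only [Finset.sum_singleton, Nat.cast_zero, mul_zero, zero_add, pow_one] at h2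
  have hl : Real.log (1 + 1 / j) ≤ 1 / j := by
    have := Real.log_le_sub_one_of_pos (x := 1 + 1 / j) (by positivity)
    linarith
  have hq : (j - s) / (j + s) = (1 - s / j) / (1 + s / j) := by field_simp
  have hq2 : j / (j + 1) = (1 + 1 / j)⁻¹ := by field_simp
  have hsj : s / j < 1 := (le_abs_self _).trans_lt ht
  have hsj0 : 0 < s / j := by positivity
  rw [← Real.log_le_log_iff (div_pos (by linarith) (by linarith)) (by positivity),
    Real.log_rpow (by positivity), hq, hq2, Real.log_div (by linarith) (by linarith), Real.log_inv]
  have : 2 * s * Real.log (1 + 1 / j) ≤ 2 * s * (1 / j) := by gcongr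
  have e : 2 * s * (1 / j) = 2 * (s / j) := by ring
  norm_num at h2
  linarith

/-- The moments of the Legendre polynomials against an endpoint singularity. -/
lemma abs_polyFracInt_legendreP_one_le {s : ℝ} (hs : 0 < s) :
    ∃ C > 0, ∀ p : ℕ, 1 ≤ p →
      |polyFracInt s (legendreP p) 1| ≤ C * (p : ℝ) ^ (-(2 * s)) := by
  have hstep : ∀ n : ℕ, |polyFracInt s (legendreP (n + 1)) 1| =
      |(n + 1 - s) / (n + 1 + s)| * |polyFracInt s (legendreP n) 1| := by
    intro n
    have h := polyFracInt_legendreP_succ_one hs n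
    have : (n + 1 + s : ℝ) ≠ 0 := by positivity
    rw [← abs_mul]
    congr 1
    field_simp
    linear_combination h
  obtain ⟨N, hN⟩ := exists_nat_ge s
  set M := |polyFracInt s (legendreP 0) 1|
  have h1 : ∀ n, |polyFracInt s (legendreP n) 1| ≤ M := by
    intro n
    induction n with
    | zero => exact le_rfl
    | succ n ih =>
      rw [hstep]
      refine (mul_le_of_le_one_left (abs_nonneg _) ?_).trans ih
      rw [abs_div, abs_of_pos (by positivity : (0 : ℝ) < n + 1 + s), div_le_one (by positivity),
        abs_le]
      constructor <;> linarith [(Nat.cast_nonneg n : (0 : ℝ) ≤ n)]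
  have h2 : ∀ n : ℕ, |polyFracInt s (legendreP n) 1| * (n + 1 : ℝ) ^ (2 * s) ≤
      M * (N + 1 : ℝ) ^ (2 * s) := by
    intro n
    rcases le_total n N with hn | hn
    · have : (n : ℝ) ≤ N := by exact_mod_cast hn
      exact mul_le_mul (h1 n) (by gcongr) (by positivity) (abs_nonneg _)
    · induction n, hn using Nat.le_induction with
      | base => exact mul_le_mul_of_nonneg_right (h1 N) (by positivity)
      | succ n hn ih =>
        have hn' : (N : ℝ) ≤ n := by exact_mod_cast hn
        refine le_trans ?_ ih
        have h3 := sub_div_add_le_rpow hs (by linarith : s ≤ n + 1)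
        rw [hstep, abs_of_nonneg (div_nonneg (by linarith) (by positivity))]
        push_cast
        calc _ ≤ ((n + 1 : ℝ) / (n + 1 + 1)) ^ (2 * s) * |polyFracInt s (legendreP n) 1| *
              (n + 1 + 1 : ℝ) ^ (2 * s) := by gcongr
          _ = _ := by
            rw [Real.div_rpow (by positivity) (by positivity)]
            field_simp
  refine ⟨M * (N + 1 : ℝ) ^ (2 * s) + 1, by positivity, fun p hp => ?_⟩
  have hp0 : (0 : ℝ) < p := by exact_mod_cast hp
  rw [Real.rpow_neg hp0.le, ← div_eq_mul_inv, le_div_iff₀ (by positivity)]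
  calc _ ≤ |polyFracInt s (legendreP p) 1| * (p + 1 : ℝ) ^ (2 * s) := by gcongr; linarith
    _ ≤ _ := by linarith [h2 p]

lemma integral_rpow_mul_sub_rpow {a b c : ℝ} (ha : 0 < a) (hb : 0 < b) (hc : 0 < c) :
    ∫ y in (0 : ℝ)..c, y ^ (a - 1) * (c - y) ^ (b - 1) =
      ProbabilityTheory.beta a b * c ^ (a + b - 1) := by
  have hβ : Complex.betaIntegral a b = (ProbabilityTheory.beta a b : ℂ) := by
    rw [Complex.betaIntegral_eq_Gamma_mul_div _ _ (by simpa) (by simpa), ProbabilityTheory.beta,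
      ← Complex.ofReal_add, Complex.Gamma_ofReal, Complex.Gamma_ofReal, Complex.Gamma_ofReal]
    push_cast
    rfl
  have h := Complex.betaIntegral_scaled a b hc
  rw [hβ] at h
  apply Complex.ofReal_injective
  rw [← intervalIntegral.integral_ofReal, Complex.ofReal_mul, mul_comm, Complex.ofReal_cpow hc.le]
  push_cast
  rw [← h]
  refine intervalIntegral.integral_congr fun y hy => ?_
  rw [uIcc_of_le hc.le] at hy
  simp only [Complex.ofReal_cpow hy.1, Complex.ofReal_cpow (sub_nonneg.2 hy.2)]
  push_cast
  rfl

lemma integral_sub_rpow_mul_sub_rpow {a b x z : ℝ} (ha : 0 < a) (hb : 0 < b) (hxz : x < z) :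
    ∫ y in x..z, (y - x) ^ (a - 1) * (z - y) ^ (b - 1) =
      ProbabilityTheory.beta a b * (z - x) ^ (a + b - 1) := by
  rw [← integral_rpow_mul_sub_rpow ha hb (sub_pos.2 hxz)]
  have := intervalIntegral.integral_comp_sub_right (a := x) (b := z)
    (fun t => t ^ (a - 1) * ((z - x) - t) ^ (b - 1)) x
  simpa using this

/-- The semigroup law for right fractional integrals. -/
lemma integral_sub_rpow_mul_integral {a b x : ℝ} (ha : 0 < a) (hb : 0 < b) (hab : 1 ≤ a + b)
    (hx : x < 1) {f : ℝ → ℝ} (hf : IntervalIntegrable f volume x 1) :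
    IntervalIntegrable (fun y => (y - x) ^ (a - 1) * ∫ z in y..1, (z - y) ^ (b - 1) * f z)
        volume x 1 ∧
      ∫ y in x..1, (y - x) ^ (a - 1) * ∫ z in y..1, (z - y) ^ (b - 1) * f z =
        ProbabilityTheory.beta a b * ∫ z in x..1, (z - x) ^ (a + b - 1) * f z := by
  set μ := volume.restrict (Ioc x 1) with hμ
  set K : ℝ → ℝ → ℝ := fun y z => if y < z then (y - x) ^ (a - 1) * (z - y) ^ (b - 1) else 0
    with hK
  have hslice : ∀ z ∈ Ioc x 1, ∀ c : ℝ, Integrable (fun y => K y z * c) μ ∧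
      ∫ y, K y z * c ∂μ = ProbabilityTheory.beta a b * ((z - x) ^ (a + b - 1) * c) := by
    intro z hz c
    have hint := integral_sub_rpow_mul_sub_rpow ha hb hz.1
    have hii : IntervalIntegrable (fun y => (y - x) ^ (a - 1) * (z - y) ^ (b - 1)) volume x z := by
      apply intervalIntegral.intervalIntegrable_of_integral_ne_zero
      rw [hint]
      have h1 := ProbabilityTheory.beta_pos ha hb
      have h2 := Real.rpow_pos_of_pos (sub_pos.2 hz.1) (a + b - 1)
      positivity
    have hKi : (fun y => K y z) =
        (Iio z).indicator (fun y => (y - x) ^ (a - 1) * (z - y) ^ (b - 1)) := by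
      ext y; simp [hK, indicator]
    have hinter : Ioc x 1 ∩ Iio z = Ioo x z := by
      ext y; simp only [mem_inter_iff, mem_Ioc, mem_Iio, mem_Ioo]
      exact ⟨fun h => ⟨h.1.1, h.2⟩, fun h => ⟨⟨h.1, h.2.le.trans hz.2⟩, h.2⟩⟩
    constructor
    · refine Integrable.mul_const ?_ c
      rw [hKi, integrable_indicator_iff measurableSet_Iio, IntegrableOn, hμ,
        Measure.restrict_restrict measurableSet_Iio, inter_comm, hinter]
      exact ((intervalIntegrable_iff_integrableOn_Ioo_of_le hz.1.le).1 hii)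
    · rw [integral_mul_const, hKi, hμ, setIntegral_indicator measurableSet_Iio, hinter,
        ← integral_Ioc_eq_integral_Ioo, ← intervalIntegral.integral_of_le hz.1.le, hint, mul_assoc]
  have hfμ : Integrable f μ := (intervalIntegrable_iff_integrableOn_Ioc_of_le hx.le).1 hf
  have hKm : Measurable (Function.uncurry K) := by
    refine Measurable.ite (measurableSet_lt measurable_fst measurable_snd) ?_ measurable_const
    fun_prop
  have hint : Integrable (Function.uncurry fun y z => K y z * f z) (μ.prod μ) := by
    have hm : AEStronglyMeasurable (Function.uncurry fun y z => K y z * f z) (μ.prod μ) :=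
      hKm.aestronglyMeasurable.mul hfμ.aestronglyMeasurable.comp_snd
    rw [integrable_prod_iff' hm]
    constructor
    · filter_upwards [ae_restrict_mem measurableSet_Ioc] with z hz using (hslice z hz (f z)).1
    · have h1 : IntervalIntegrable
          (fun z => ProbabilityTheory.beta a b * ((z - x) ^ (a + b - 1) * |f z|)) volume x 1 := by
        refine (IntervalIntegrable.continuousOn_mul hf.abs ?_).const_mul _
        exact (continuous_id.sub continuous_const).continuousOn.rpow_const
          fun _ _ => Or.inr (by linarith)
      refine ((intervalIntegrable_iff_integrableOn_Ioc_of_le hx.le).1 h1).congr ?_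
      filter_upwards [ae_restrict_mem measurableSet_Ioc] with z hz
      rw [← (hslice z hz _).2]
      refine setIntegral_congr_fun measurableSet_Ioc fun y hy => ?_
      have : 0 ≤ K y z := by
        simp only [hK]
        split_ifs with h
        · exact mul_nonneg (Real.rpow_nonneg (by linarith [hy.1]) _)
            (Real.rpow_nonneg (by linarith) _)
        · exact le_rfl
      simp [abs_of_nonneg this]
  have hswap := integral_integral_swap hint
  have hinner : ∀ y ∈ Ioc x 1, ∫ z, K y z * f z ∂μ =
      (y - x) ^ (a - 1) * ∫ z in y..1, (z - y) ^ (b - 1) * f z := by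
    intro y hy
    have hKi : (fun z => K y z * f z) =
        (Ioi y).indicator (fun z => (y - x) ^ (a - 1) * ((z - y) ^ (b - 1) * f z)) := by
      ext z
      by_cases h : y < z <;> simp [hK, indicator, h, mul_assoc]
    have hinter : Ioc x 1 ∩ Ioi y = Ioc y 1 := by
      ext z; simp only [mem_inter_iff, mem_Ioc, mem_Ioi]
      exact ⟨fun h => ⟨h.2, h.1.2⟩, fun h => ⟨⟨hy.1.trans h.1, h.2⟩, h.1⟩⟩
    rw [hKi, setIntegral_indicator measurableSet_Ioi, hinter, integral_const_mul,
      intervalIntegral.integral_of_le hy.2]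
  constructor
  · refine (intervalIntegrable_iff_integrableOn_Ioc_of_le hx.le).2
      (hint.integral_prod_left.congr ?_)
    filter_upwards [ae_restrict_mem measurableSet_Ioc] with y hy using hinner y hy
  · rw [intervalIntegral.integral_of_le hx.le, intervalIntegral.integral_of_le hx.le,
      ← integral_const_mul, ← setIntegral_congr_fun measurableSet_Ioc hinner]
    exact hswap.trans (setIntegral_congr_fun measurableSet_Ioc fun z hz => (hslice z hz _).2)

lemma exists_tendsto_left_of_intervalIntegrable {f f' : ℝ → ℝ} {a b : ℝ} (hab : a < b)
    (h : ∀ x ∈ Ioo a b, HasDerivAt f (f' x) x) (hi : IntervalIntegrable f' volume a b) :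
    ∃ l, Tendsto f (nhdsWithin b (Iio b)) (nhds l) := by
  obtain ⟨c, hc⟩ := nonempty_Ioo.2 hab
  have hcb : IntervalIntegrable f' volume c b :=
    hi.mono_set (by rw [uIcc_of_le hc.2.le, uIcc_of_le hab.le]; exact Icc_subset_Icc_left hc.1.le)
  have hcont := intervalIntegral.continuousOn_primitive_interval' hcb left_mem_uIcc b right_mem_uIcc
  rw [uIcc_of_le hc.2.le] at hcont
  have h1 := (hcont.mono Ioo_subset_Icc_self).tendsto.const_add (f c)
  rw [nhdsWithin_Ioo_eq_nhdsLT hc.2] at h1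
  refine ⟨_, h1.congr' ?_⟩
  filter_upwards [Ioo_mem_nhdsLT hc.2] with x hx
  have : ∫ t in c..x, f' t = f x - f c := by
    refine intervalIntegral.integral_eq_sub_of_hasDerivAt (fun t ht => h t ?_) (hcb.mono_set ?_)
    · rw [uIcc_of_le hx.1.le] at ht
      exact ⟨hc.1.trans_le ht.1, ht.2.trans_lt hx.2⟩
    · rw [uIcc_of_le hc.2.le, uIcc_of_le hx.1.le]; exact Icc_subset_Icc_right hx.2.le
  rw [this]; ring

lemma hasDerivAt_sum_taylor (n : ℕ) (u : ℕ → ℝ → ℝ) (x y : ℝ)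
    (h : ∀ i ≤ n, HasDerivAt (u i) (u (i + 1) y) y) :
    HasDerivAt
      (fun t => ∑ i ∈ Finset.range (n + 1), (-1) ^ i * u i t * (t - x) ^ i / i.factorial)
      ((-1) ^ n * u (n + 1) y * (y - x) ^ n / n.factorial) y := by
  induction n with
  | zero => simpa using h 0 le_rfl
  | succ n ih =>
    have h1 := ih fun i hi => h i (by omega)
    have h2 := (((h (n + 1) le_rfl).const_mul ((-1) ^ (n + 1))).mul
      (((hasDerivAt_id y).sub_const x).pow (n + 1))).div_const ((n + 1).factorial : ℝ)
    simp only [Finset.sum_range_succ _ (n + 1)]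
    refine (h1.add h2).congr_deriv ?_
    have hf : (n.factorial : ℝ) ≠ 0 := by positivity
    simp only [Nat.factorial_succ, id, Nat.add_sub_cancel, Pi.pow_apply]
    push_cast
    field_simp
    ring

/-- Taylor's formula at the right endpoint, with integral remainder. -/
lemma taylor_left_limit (n : ℕ) (u : ℕ → ℝ → ℝ) (L : ℕ → ℝ) {a b : ℝ}
    (h : ∀ i ≤ n, ∀ y ∈ Ioo a b, HasDerivAt (u i) (u (i + 1) y) y)
    (hi : IntervalIntegrable (u (n + 1)) volume a b)
    (hL : ∀ i ≤ n, Tendsto (u i) (nhdsWithin b (Iio b)) (nhds (L i))) {x : ℝ} (hx : x ∈ Ioo a b) :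
    u 0 x = ∑ i ∈ Finset.range (n + 1), (-1) ^ i * L i * (b - x) ^ i / i.factorial +
      (-1) ^ (n + 1) / n.factorial * ∫ y in x..b, (y - x) ^ n * u (n + 1) y := by
  have hxb : IntervalIntegrable (u (n + 1)) volume x b :=
    hi.mono_set (by
      rw [uIcc_of_le hx.2.le, uIcc_of_le (hx.1.trans hx.2).le]
      exact Icc_subset_Icc_left hx.1.le)
  have hd := fun y (hy : y ∈ Ioo a b) => hasDerivAt_sum_taylor n u x y fun i hi => h i hi y hy
  have key := intervalIntegral.integral_eq_sub_of_hasDerivAt_of_tendsto hx.2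
    (fun y hy => hd y ⟨hx.1.trans hy.1, hy.2⟩) ?_ ((hd x hx).continuousAt.mono_left
      nhdsWithin_le_nhds) (tendsto_finsetSum _ fun i hi =>
      (((hL i (by simpa [Nat.lt_succ_iff] using hi)).const_mul ((-1) ^ i)).mul
        (((continuous_id.sub continuous_const).pow i).tendsto b |>.mono_left
          nhdsWithin_le_nhds)).div_const (i.factorial : ℝ))
  · have h0 : ∑ i ∈ Finset.range (n + 1), (-1) ^ i * u i x * (x - x) ^ i / i.factorial = u 0 x := by
      rw [Finset.sum_range_succ']
      simp
    have h1 : (fun y => (-1) ^ n * u (n + 1) y * (y - x) ^ n / n.factorial) =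
        fun y => (-1) ^ n / n.factorial * ((y - x) ^ n * u (n + 1) y) := by
      ext y; ring
    rw [h1, intervalIntegral.integral_const_mul] at key
    simp only [h0, Pi.pow_apply, Pi.sub_apply, id] at key
    rw [pow_succ]
    linear_combination key
  · exact (((hxb.const_mul ((-1) ^ n)).mul_continuousOn
      ((continuous_id.sub continuous_const).pow n).continuousOn).div_const _)

lemma intervalIntegrable_sub_rpow_left {r : ℝ} (hr : -1 < r) (x a b : ℝ) :
    IntervalIntegrable (fun y => (y - x) ^ r) volume a b := by
  simpa using (intervalIntegral.intervalIntegrable_rpow' (a := a - x) (b := b - x) hr).comp_sub_right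
    x

/-- A function with a Taylor expansion at `1` has fractional integrals with a matching fractional
expansion. -/
lemma integral_sub_rpow_mul_taylor {a x : ℝ} (ha : 0 < a) (hx : x < 1) (n : ℕ) {g f : ℝ → ℝ}
    (hf : IntervalIntegrable f volume x 1) (b : ℕ → ℝ) (d : ℝ)
    (hg : ∀ y ∈ Ioo x 1, g y = ∑ i ∈ Finset.range (n + 1), b i * (1 - y) ^ i +
      d * ∫ z in y..1, (z - y) ^ n * f z) :
    ∫ y in x..1, (y - x) ^ (a - 1) * g y =
      ∑ i ∈ Finset.range (n + 1), b i * (ProbabilityTheory.beta a (i + 1) * (1 - x) ^ (a + i)) +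
      d * (ProbabilityTheory.beta a (n + 1) * ∫ z in x..1, (z - x) ^ (a + n) * f z) := by
  obtain ⟨h1, h2⟩ := integral_sub_rpow_mul_integral ha (b := n + 1) (by positivity)
    (by linarith [(Nat.cast_nonneg n : (0 : ℝ) ≤ n)]) hx hf
  simp only [add_sub_cancel_right, ← add_assoc, Real.rpow_natCast] at h1 h2
  have h3 : ∀ i : ℕ, ∫ y in x..1, (y - x) ^ (a - 1) * (1 - y) ^ i =
      ProbabilityTheory.beta a (i + 1) * (1 - x) ^ (a + i) := by
    intro i
    have := integral_sub_rpow_mul_sub_rpow (b := i + 1) ha (by positivity) hx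
    simpa only [add_sub_cancel_right, ← add_assoc, Real.rpow_natCast] using this
  have hii : ∀ i ∈ Finset.range (n + 1),
      IntervalIntegrable (fun y => b i * ((y - x) ^ (a - 1) * (1 - y) ^ i)) volume x 1 := by
    intro i _
    exact ((intervalIntegrable_sub_rpow_left (by linarith) x x 1).mul_continuousOn
      ((continuous_const.sub continuous_id).pow i).continuousOn).const_mul _
  have hcongr : ∫ y in x..1, (y - x) ^ (a - 1) * g y =
      ∫ y in x..1, (∑ i ∈ Finset.range (n + 1), b i * ((y - x) ^ (a - 1) * (1 - y) ^ i) +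
        d * ((y - x) ^ (a - 1) * ∫ z in y..1, (z - y) ^ n * f z)) := by
    rw [intervalIntegral.integral_of_le hx.le, intervalIntegral.integral_of_le hx.le,
      integral_Ioc_eq_integral_Ioo, integral_Ioc_eq_integral_Ioo]
    refine setIntegral_congr_fun measurableSet_Ioo fun y hy => ?_
    simp only [hg y hy, mul_add, Finset.mul_sum]
    congr 1
    · exact Finset.sum_congr rfl fun i _ => by ring
    · ring
  have hsum : IntervalIntegrable
      (fun y => ∑ i ∈ Finset.range (n + 1), b i * ((y - x) ^ (a - 1) * (1 - y) ^ i)) volume x 1 := by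
    simpa only [Finset.sum_fn] using IntervalIntegrable.sum _ hii
  rw [hcongr, intervalIntegral.integral_add hsum (h1.const_mul d),
    intervalIntegral.integral_finsetSum hii, intervalIntegral.integral_const_mul, h2]
  simp only [intervalIntegral.integral_const_mul, h3]

lemma integral_max_sub_rpow_mul {s x : ℝ} (hs : 0 < s) (hx : x ∈ Icc (-1 : ℝ) 1) {f : ℝ → ℝ}
    (hf : IntervalIntegrable f volume (-1) 1) :
    ∫ y in (-1 : ℝ)..1, max (y - x) 0 ^ s * f y = ∫ y in x..1, (y - x) ^ s * f y := by
  have hi : IntervalIntegrable (fun y => max (y - x) 0 ^ s * f y) volume (-1) 1 :=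
    hf.continuousOn_mul (((continuous_id.sub continuous_const).max continuous_const).rpow_const
      fun _ => Or.inr hs.le).continuousOn
  have hx' : x ∈ uIcc (-1 : ℝ) 1 := by rwa [uIcc_of_le (by norm_num)]
  rw [← intervalIntegral.integral_add_adjacent_intervals
    (hi.mono_set (uIcc_subset_uIcc_left hx')) (hi.mono_set (uIcc_subset_uIcc_right hx'))]
  have h1 : ∫ y in (-1 : ℝ)..x, max (y - x) 0 ^ s * f y = ∫ y in (-1 : ℝ)..x, (0 : ℝ) := by
    refine intervalIntegral.integral_congr fun y hy => ?_
    rw [uIcc_of_le hx.1] at hy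
    simp [max_eq_right (sub_nonpos.2 hy.2), Real.zero_rpow hs.ne']
  have h2 : ∫ y in x..1, max (y - x) 0 ^ s * f y = ∫ y in x..1, (y - x) ^ s * f y := by
    refine intervalIntegral.integral_congr fun y hy => ?_
    rw [uIcc_of_le hx.2] at hy
    simp [max_eq_left (sub_nonneg.2 hy.1)]
  rw [h1, h2, intervalIntegral.integral_zero, zero_add]

lemma continuousOn_integral_max_sub_rpow_mul {s : ℝ} (hs : 0 < s) {f : ℝ → ℝ}
    (hf : IntervalIntegrable f volume (-1) 1) :
    ContinuousOn (fun x => ∫ y in (-1 : ℝ)..1, max (y - x) 0 ^ s * f y) (Icc (-1) 1) := by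
  have hc : Continuous fun q : ℝ × ℝ => max (q.2 - q.1) 0 ^ s :=
    ((continuous_snd.sub continuous_fst).max continuous_const).rpow_const fun _ => Or.inr hs.le
  have hfμ := (intervalIntegrable_iff_integrableOn_Ioc_of_le (by norm_num)).1 hf
  simp only [intervalIntegral.integral_of_le (by norm_num : (-1 : ℝ) ≤ 1)]
  refine continuousOn_of_dominated (bound := fun y => 2 ^ s * |f y|) (fun x _ => ?_)
    (fun x hx => ?_) (hfμ.abs.const_mul _) (ae_of_all _ fun y => ?_)
  · exact (hc.comp (Continuous.prodMk_right x)).aestronglyMeasurable.mul hfμ.aestronglyMeasurable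
  · filter_upwards [ae_restrict_mem measurableSet_Ioc] with y hy
    rw [norm_mul, Real.norm_of_nonneg (by positivity), Real.norm_eq_abs]
    gcongr
    exact max_le (by linarith [hy.2, hx.1]) (by norm_num)
  · exact ((hc.comp (Continuous.prodMk_left y)).mul continuous_const).continuousOn

/-- Up to a polynomial, a function is the fractional integral of its Caputo derivative. -/
lemma MemUR.eq_add_integral {k m : ℕ} {α : ℝ} (hk : 1 ≤ k) (hα1 : (k : ℝ) - 1 < α)
    (hα2 : α < k) {ω : ℝ → ℝ} {L : ℕ → ℝ} (h : MemUR k m α ω L) :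
    ∃ T : Polynomial ℝ, T.natDegree < k ∧ ∀ x ∈ Ioo (-1 : ℝ) 1,
      ω x = T.eval x + Real.Gamma (k - α) / (ProbabilityTheory.beta α (k - α) *
        (k - 1).factorial) * ∫ y in x..1, (y - x) ^ (α - 1) * caputoR k α 1 ω y := by
  obtain ⟨k, rfl⟩ : ∃ j, k = j + 1 := ⟨k - 1, by omega⟩
  obtain ⟨-, hd, hi, -⟩ := h
  have hk0 : (0 : ℝ) ≤ k := Nat.cast_nonneg k
  have hα0 : 0 < α := by push_cast at hα1; linarith
  have hlim : ∀ i, ∃ l, i ≤ k → Tendsto (iteratedDeriv i ω) (nhdsWithin 1 (Iio 1)) (nhds l) := by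
    intro i
    by_cases hik : i ≤ k
    · obtain ⟨l, hl⟩ := exists_tendsto_left_of_intervalIntegrable (by norm_num)
        (hd i (by omega)) (hi (i + 1) (by omega))
      exact ⟨l, fun _ => hl⟩
    · exact ⟨0, fun h => absurd h hik⟩
  choose l hl using hlim
  refine ⟨∑ i ∈ Finset.range (k + 1),
    Polynomial.C ((-1) ^ i * l i / i.factorial) * (1 - Polynomial.X) ^ i, ?_, fun x hx => ?_⟩
  · refine Nat.lt_succ_of_le (Polynomial.natDegree_sum_le_of_forall_le _ _ fun i hi => ?_)
    have : i ≤ k := by simpa [Nat.lt_succ_iff] using hi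
    refine le_trans ?_ this
    compute_degree
  have ht := taylor_left_limit k (fun i => iteratedDeriv i ω) l
    (fun i hik y hy => hd i (by omega) y hy) (hi (k + 1) le_rfl) hl hx
  have hxi : IntervalIntegrable (iteratedDeriv (k + 1) ω) volume x 1 :=
    (hi (k + 1) le_rfl).mono_set
      (uIcc_subset_uIcc_right (by rw [uIcc_of_le (by norm_num)]; exact Ioo_subset_Icc_self hx))
  have hs := (integral_sub_rpow_mul_integral hα0 (b := (k + 1 : ℕ) - α) (by linarith)
    (by push_cast; linarith) hx.2 hxi).2
  rw [show α + (((k + 1 : ℕ) : ℝ) - α) - 1 = k by push_cast; ring] at hs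
  simp only [Real.rpow_natCast] at hs
  have hB := ProbabilityTheory.beta_pos hα0 (by linarith : 0 < ((k + 1 : ℕ) : ℝ) - α)
  have hΓ := Real.Gamma_pos_of_pos (by linarith : 0 < ((k + 1 : ℕ) : ℝ) - α)
  have hg : ∫ y in x..1, (y - x) ^ (α - 1) * caputoR (k + 1) α 1 ω y =
      (-1) ^ (k + 1) / Real.Gamma (((k + 1 : ℕ) : ℝ) - α) *
        (ProbabilityTheory.beta α ((k + 1 : ℕ) - α) *
          ∫ y in x..1, (y - x) ^ k * iteratedDeriv (k + 1) ω y) := by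
    rw [← hs, ← intervalIntegral.integral_const_mul]
    refine intervalIntegral.integral_congr fun y _ => ?_
    simp only [caputoR]
    ring
  simp only [iteratedDeriv_zero] at ht
  rw [ht, hg, Polynomial.eval_finsetSum]
  congr 1
  · refine Finset.sum_congr rfl fun i _ => ?_
    simp
    ring
  · rw [Nat.add_sub_cancel]
    field_simp

lemma MemUR.exists_representation {k m : ℕ} {α : ℝ} (hk : 1 ≤ k) (hm : 1 ≤ m)
    (hα1 : (k : ℝ) - 1 < α) (hα2 : α < k) :
    ∃ (c : ℕ → ℝ) (d : ℝ), ∀ (ω : ℝ → ℝ) (L : ℕ → ℝ), MemUR k m α ω L →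
      ∃ T : Polynomial ℝ, T.natDegree < k ∧ ∀ x ∈ Icc (-1 : ℝ) 1,
        ω x = T.eval x + (∑ i ∈ Finset.range m, c i * L i * (1 - x) ^ (α + i)) +
          d * ∫ y in (-1 : ℝ)..1,
            max (y - x) 0 ^ (α + m - 1) * iteratedDeriv m (caputoR k α 1 ω) y := by
  obtain ⟨m, rfl⟩ : ∃ j, m = j + 1 := ⟨m - 1, by omega⟩
  have hk1 : (1 : ℝ) ≤ k := by exact_mod_cast hk
  have hα0 : 0 < α := by linarith
  have hm0 : (0 : ℝ) ≤ m := Nat.cast_nonneg m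
  set c₀ := Real.Gamma (k - α) / (ProbabilityTheory.beta α (k - α) * (k - 1).factorial) with hc₀
  refine ⟨fun i => c₀ * ((-1) ^ i / i.factorial * ProbabilityTheory.beta α (i + 1)),
    c₀ * ((-1) ^ (m + 1) / m.factorial * ProbabilityTheory.beta α (m + 1)), fun ω L h => ?_⟩
  obtain ⟨T, hT, hω⟩ := h.eq_add_integral hk hα1 hα2
  obtain ⟨hcont, -, -, hd, hi, hL⟩ := h
  refine ⟨T, hT, ?_⟩
  rw [show α + ((m + 1 : ℕ) : ℝ) - 1 = α + m by push_cast; ring]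
  refine EqOn.of_subset_closure (s := Ioo (-1) 1) (fun x hx => ?_) hcont ?_ Ioo_subset_Icc_self
    (by rw [closure_Ioo (by norm_num)])
  · have hxI : x ∈ Icc (-1 : ℝ) 1 := Ioo_subset_Icc_self hx
    have hgm : IntervalIntegrable (iteratedDeriv (m + 1) (caputoR k α 1 ω)) volume x 1 :=
      (hi (m + 1) le_rfl).mono_set
        (uIcc_subset_uIcc_right (by rwa [uIcc_of_le (by norm_num)]))
    have ht := integral_sub_rpow_mul_taylor hα0 hx.2 m hgm
      (fun i => (-1) ^ i * L i / i.factorial) ((-1) ^ (m + 1) / m.factorial)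
      (g := caputoR k α 1 ω) fun y hy => by
        have := taylor_left_limit m (fun i => iteratedDeriv i (caputoR k α 1 ω)) L
          (fun i him y hy => hd i (by omega) y hy) (hi (m + 1) le_rfl)
          (fun i him => hL i (by omega)) ⟨hx.1.trans hy.1, hy.2⟩
        simp only [iteratedDeriv_zero] at this
        rw [this]
        congr 1
        exact Finset.sum_congr rfl fun i _ => by ring
    simp only [hω x hx, integral_max_sub_rpow_mul (by linarith : 0 < α + m) hxI (hi (m + 1) le_rfl),
      ← hc₀, ht, mul_add, Finset.mul_sum, ← add_assoc]
    congr 1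
    · congr 1
      exact Finset.sum_congr rfl fun i _ => by ring
    · ring
  · refine (T.continuous.continuousOn.add (continuousOn_finsetSum _ fun i _ => ?_)).add
      (continuousOn_const.mul
        (continuousOn_integral_max_sub_rpow_mul (by linarith) (hi (m + 1) le_rfl)))
    exact (continuous_const.mul ((continuous_const.sub continuous_id).rpow_const
      fun _ => Or.inr (by positivity))).continuousOn

lemma integral_mul_derivative_legendreP {p : ℕ} (hp : 1 ≤ p) (q : Polynomial ℝ)
    (hq : q.natDegree ≤ p) :
    ∫ x in (-1 : ℝ)..1, q.eval x * (legendreP p).derivative.eval x =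
      q.eval 1 - (-1) ^ p * q.eval (-1) := by
  have hq' : q.derivative.natDegree < p := by
    have := Polynomial.natDegree_derivative_le q
    omega
  rw [integral_derivative_mul_legendreP _ q _ _ _ rfl, integral_mul_legendreP_eq_zero p _ hq',
    legendreP_eval_one, legendreP_eval_neg_one]
  ring

/-- The two endpoint errors of a polynomial projection are coupled by orthogonality to the
derivative of the Legendre polynomial. -/
lemma endpoint_errors_eq {p : ℕ} (hp : 1 ≤ p) {ω : ℝ → ℝ} (hω : ContinuousOn ω (Icc (-1) 1))
    {P : Polynomial ℝ} (hP : P.natDegree ≤ p)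
    (horth : ∀ v : Polynomial ℝ, v.natDegree < p →
      ∫ x in (-1 : ℝ)..1, (P.eval x - ω x) * v.eval x = 0) :
    (ω 1 - P.eval 1) - (-1) ^ p * (ω (-1) - P.eval (-1)) =
      ω 1 - (-1) ^ p * ω (-1) - ∫ x in (-1 : ℝ)..1, ω x * (legendreP p).derivative.eval x := by
  have h := horth (legendreP p).derivative (by
    have := Polynomial.natDegree_derivative_le (legendreP p)
    have := natDegree_legendreP_le p
    omega)
  have hi : IntervalIntegrable (fun x => ω x * (legendreP p).derivative.eval x) volume (-1) 1 :=
    (hω.mul (legendreP p).derivative.continuous.continuousOn).intervalIntegrable_of_Icc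
      (by norm_num)
  have hiP : IntervalIntegrable (fun x => P.eval x * (legendreP p).derivative.eval x)
      volume (-1) 1 :=
    (P.continuous.mul (legendreP p).derivative.continuous).intervalIntegrable _ _
  simp only [sub_mul] at h
  rw [intervalIntegral.integral_sub hiP hi, integral_mul_derivative_legendreP hp P hP] at h
  linear_combination -h

lemma integral_max_sub_rpow_mul_derivative {s y : ℝ} (hs : 0 < s) (hy : y ∈ Icc (-1 : ℝ) 1)
    (F : Polynomial ℝ) :
    ∫ x in (-1 : ℝ)..1, max (y - x) 0 ^ s * F.derivative.eval x =
      s * polyFracInt s F y - (y + 1) ^ s * F.eval (-1) := by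
  have hi : IntervalIntegrable (fun x => max (y - x) 0 ^ s * F.derivative.eval x) volume (-1) 1 :=
    ((((continuous_const.sub continuous_id).max continuous_const).rpow_const
      fun _ => Or.inr hs.le).mul F.derivative.continuous).intervalIntegrable _ _
  have hy' : y ∈ uIcc (-1 : ℝ) 1 := by rwa [uIcc_of_le (by norm_num)]
  rw [← integral_sub_rpow_mul_derivative F hs hy.1,
    ← intervalIntegral.integral_add_adjacent_intervals
    (hi.mono_set (uIcc_subset_uIcc_left hy')) (hi.mono_set (uIcc_subset_uIcc_right hy'))]
  have h1 : ∫ x in (-1 : ℝ)..y, max (y - x) 0 ^ s * F.derivative.eval x =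
      ∫ x in (-1 : ℝ)..y, (y - x) ^ s * F.derivative.eval x := by
    refine intervalIntegral.integral_congr fun x hx => ?_
    rw [uIcc_of_le hy.1] at hx
    simp [max_eq_left (sub_nonneg.2 hx.2)]
  have h2 : ∫ x in y..1, max (y - x) 0 ^ s * F.derivative.eval x = ∫ x in y..1, (0 : ℝ) := by
    refine intervalIntegral.integral_congr fun x hx => ?_
    rw [uIcc_of_le hy.2] at hx
    simp [max_eq_right (sub_nonpos.2 hx.1), Real.zero_rpow hs.ne']
  rw [h1, h2, intervalIntegral.integral_zero, add_zero]

lemma integral_integral_max_sub_rpow_mul_derivative {s : ℝ} (hs : 0 < s) {f : ℝ → ℝ}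
    (hf : IntervalIntegrable f volume (-1) 1) (F : Polynomial ℝ) :
    ∫ x in (-1 : ℝ)..1, (∫ y in (-1 : ℝ)..1, max (y - x) 0 ^ s * f y) * F.derivative.eval x =
      s * (∫ y in (-1 : ℝ)..1, polyFracInt s F y * f y) -
        F.eval (-1) * ∫ y in (-1 : ℝ)..1, max (y - -1) 0 ^ s * f y := by
  have hle : (-1 : ℝ) ≤ 1 := by norm_num
  set μ := volume.restrict (Ioc (-1 : ℝ) 1) with hμ
  have hfμ : Integrable f μ := (intervalIntegrable_iff_integrableOn_Ioc_of_le hle).1 hf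
  have hc : Continuous fun q : ℝ × ℝ => max (q.2 - q.1) 0 ^ s * F.derivative.eval q.1 :=
    (((continuous_snd.sub continuous_fst).max continuous_const).rpow_const
      fun _ => Or.inr hs.le).mul (F.derivative.continuous.comp continuous_fst)
  obtain ⟨M, hM⟩ := (isCompact_Icc (a := (-1 : ℝ)) (b := 1)).prod isCompact_Icc
    |>.exists_bound_of_continuousOn hc.continuousOn
  have hint : Integrable (Function.uncurry fun x y =>
      (max (y - x) 0 ^ s * F.derivative.eval x) * f y) (μ.prod μ) := by
    refine Integrable.bdd_mul (c := M) (hfμ.comp_snd μ) hc.aestronglyMeasurable ?_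
    rw [hμ, Measure.prod_restrict]
    filter_upwards [ae_restrict_mem (measurableSet_Ioc.prod measurableSet_Ioc)] with q hq
    exact hM q ⟨Ioc_subset_Icc_self hq.1, Ioc_subset_Icc_self hq.2⟩
  have hinner : ∀ y ∈ Ioc (-1 : ℝ) 1,
      ∫ x, (max (y - x) 0 ^ s * F.derivative.eval x) * f y ∂μ =
        s * (polyFracInt s F y * f y) - F.eval (-1) * (max (y - -1) 0 ^ s * f y) := by
    intro y hy
    rw [integral_mul_const, hμ, ← intervalIntegral.integral_of_le hle,
      integral_max_sub_rpow_mul_derivative hs (Ioc_subset_Icc_self hy), sub_neg_eq_add,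
      max_eq_left (by linarith [hy.1])]
    ring
  have hi2 : Integrable (fun y => max (y - -1) 0 ^ s * f y) μ := by
    refine (intervalIntegrable_iff_integrableOn_Ioc_of_le hle).1 (hf.continuousOn_mul ?_)
    exact (((continuous_id.sub continuous_const).max continuous_const).rpow_const
      fun _ => Or.inr hs.le).continuousOn
  have hi1 : Integrable (fun y => polyFracInt s F y * f y) μ := by
    have h1 : Integrable (fun y => ∫ x, (max (y - x) 0 ^ s * F.derivative.eval x) * f y ∂μ) μ :=
      hint.integral_prod_right
    have h2 := (h1.add (hi2.const_mul (F.eval (-1)))).const_mul s⁻¹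
    refine h2.congr ?_
    filter_upwards [ae_restrict_mem measurableSet_Ioc] with y hy
    rw [Pi.add_apply, hinner y hy]
    field_simp
    ring
  have hswap := integral_integral_swap hint
  simp only [intervalIntegral.integral_of_le hle, ← integral_const_mul]
  rw [← integral_sub (hi1.const_mul s) (hi2.const_mul _),
    ← setIntegral_congr_fun measurableSet_Ioc hinner]
  refine Eq.trans (integral_congr_ae (ae_of_all _ fun x => ?_)) hswap
  simp only [← integral_mul_const]
  exact integral_congr_ae (ae_of_all _ fun y => by ring)

/-- The endpoint functional of a function with a fractional expansion at `1`. -/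
lemma endpoint_functional_eq {p m : ℕ} {α s : ℝ} (hp : 1 ≤ p) (hα : 0 < α) (hs : 0 < s)
    {ω f : ℝ → ℝ} (hf : IntervalIntegrable f volume (-1) 1) (b : ℕ → ℝ) (d : ℝ)
    {T : Polynomial ℝ} (hT : T.natDegree ≤ p)
    (hω : ∀ x ∈ Icc (-1 : ℝ) 1, ω x = T.eval x +
      (∑ i ∈ Finset.range m, b i * (1 - x) ^ (α + i)) +
        d * ∫ y in (-1 : ℝ)..1, max (y - x) 0 ^ s * f y) :
    ω 1 - (-1) ^ p * ω (-1) - ∫ x in (-1 : ℝ)..1, ω x * (legendreP p).derivative.eval x =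
      -((∑ i ∈ Finset.range m, b i * ((α + i) * polyFracInt (α + i) (legendreP p) 1)) +
        d * (s * ∫ y in (-1 : ℝ)..1, polyFracInt s (legendreP p) y * f y)) := by
  set Q := (legendreP p).derivative with hQ
  have hQc : ContinuousOn (fun x => Q.eval x) (uIcc (-1) 1) := Q.continuous.continuousOn
  have hpos : ∀ i : ℕ, 0 < α + i := fun i => by positivity
  have hcongr : ∫ x in (-1 : ℝ)..1, ω x * Q.eval x = ∫ x in (-1 : ℝ)..1,
      (T.eval x * Q.eval x + (∑ i ∈ Finset.range m, b i * ((1 - x) ^ (α + i) * Q.eval x)) +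
        d * ((∫ y in (-1 : ℝ)..1, max (y - x) 0 ^ s * f y) * Q.eval x)) := by
    refine intervalIntegral.integral_congr fun x hx => ?_
    rw [uIcc_of_le (by norm_num)] at hx
    simp only [hω x hx, add_mul, Finset.sum_mul, mul_assoc]
  have hi1 : IntervalIntegrable (fun x => T.eval x * Q.eval x) volume (-1) 1 :=
    (T.continuous.mul Q.continuous).intervalIntegrable _ _
  have hi2 : ∀ i ∈ Finset.range m,
      IntervalIntegrable (fun x => b i * ((1 - x) ^ (α + i) * Q.eval x)) volume (-1) 1 :=
    fun i _ => (intervalIntegrable_sub_rpow_mul_eval (by linarith [hpos i]) _ _ _ _).const_mul _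
  have hi2' : IntervalIntegrable
      (fun x => ∑ i ∈ Finset.range m, b i * ((1 - x) ^ (α + i) * Q.eval x)) volume (-1) 1 := by
    simpa only [Finset.sum_fn] using IntervalIntegrable.sum _ hi2
  have hi3 : IntervalIntegrable
      (fun x => (∫ y in (-1 : ℝ)..1, max (y - x) 0 ^ s * f y) * Q.eval x) volume (-1) 1 :=
    ((continuousOn_integral_max_sub_rpow_mul hs hf).mul Q.continuous.continuousOn
      |>.intervalIntegrable_of_Icc (by norm_num))
  rw [hcongr, intervalIntegral.integral_add (hi1.add hi2') (hi3.const_mul d),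
    intervalIntegral.integral_add hi1 hi2', intervalIntegral.integral_finsetSum hi2,
    intervalIntegral.integral_const_mul, hQ, integral_mul_derivative_legendreP hp T hT,
    integral_integral_max_sub_rpow_mul_derivative hs hf]
  simp only [intervalIntegral.integral_const_mul]
  have h3 : ∀ i : ℕ, ∫ x in (-1 : ℝ)..1, (1 - x) ^ (α + i) * (legendreP p).derivative.eval x =
      (α + i) * polyFracInt (α + i) (legendreP p) 1 - (1 - -1) ^ (α + i) * (-1) ^ p := by
    intro i
    rw [integral_sub_rpow_mul_derivative _ (hpos i) (by norm_num), legendreP_eval_neg_one,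
      sub_neg_eq_add]
  have h1 : ω 1 = T.eval 1 := by
    rw [hω 1 (by simp), integral_max_sub_rpow_mul hs (by simp) hf]
    simp [fun i : ℕ => Real.zero_rpow (hpos i).ne']
  simp only [h3, h1, hω (-1) (by simp), legendreP_eval_neg_one, mul_sub, Finset.sum_sub_distrib,
    mul_add, Finset.mul_sum]
  rw [← sub_eq_zero]
  have h4 : ∑ i ∈ Finset.range m, (-1) ^ p * (b i * (1 - -1) ^ (α + i)) =
      ∑ i ∈ Finset.range m, b i * ((1 - -1) ^ (α + i) * (-1) ^ p) :=
    Finset.sum_congr rfl fun i _ => by ring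
  rw [h4]
  ring

lemma exists_abs_endpoint_functional_le (k m : ℕ) (hk : 1 ≤ k) (hm : 1 ≤ m) (α : ℝ)
    (hα1 : (k : ℝ) - 1 < α) (hα2 : α < k) (hαint : ∀ j : ℤ, α ≠ j) :
    ∃ C > (0 : ℝ), ∀ p : ℕ, α + m < (p : ℝ) + 1 → ∀ (ω : ℝ → ℝ) (L : ℕ → ℝ), MemUR k m α ω L →
      |ω 1 - (-1) ^ p * ω (-1) - ∫ x in (-1 : ℝ)..1, ω x * (legendreP p).derivative.eval x| ≤
        C * (p : ℝ) ^ (-(min (2 * α) (α + m - 1 / 2))) * UsemiR k m α ω L := by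
  have hk1 : (1 : ℝ) ≤ k := by exact_mod_cast hk
  have hm1 : (1 : ℝ) ≤ m := by exact_mod_cast hm
  have hα0 : 0 < α := by linarith
  obtain ⟨c, d, hrep⟩ := MemUR.exists_representation (m := m) hk hm hα1 hα2
  set s := α + m - 1 with hs
  have hs0 : 0 < s := by linarith
  obtain ⟨C₁, hC₁, hb₁⟩ := abs_polyFracInt_legendreP_le hs0 (fun j hj => hαint (j - m + 1) (by
    push_cast; linarith))
  have hpos : ∀ i : ℕ, 0 < α + i := fun i => by positivity
  choose C₂ hC₂ hb₂ using fun i : ℕ => abs_polyFracInt_legendreP_one_le (hpos i)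
  set D := ∑ i ∈ Finset.range m, |c i| * ((α + i) * C₂ i)
  have hD : ∀ i ∈ Finset.range m, |c i| * ((α + i) * C₂ i) ≤ D := fun i hi =>
    Finset.single_le_sum (f := fun i : ℕ => |c i| * ((α + i) * C₂ i))
      (fun i _ => mul_nonneg (abs_nonneg _) (mul_nonneg (hpos i).le (hC₂ i).le)) hi
  have hD0 : 0 ≤ D := Finset.sum_nonneg fun i _ =>
    mul_nonneg (abs_nonneg _) (mul_nonneg (hpos i).le (hC₂ i).le)
  refine ⟨D + |d| * (s * C₁) + 1, by positivity, fun p hp ω L h => ?_⟩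
  obtain ⟨T, hT, hω⟩ := hrep ω L h
  have hsp : s < p := by linarith
  have hp1 : 1 ≤ p := Nat.cast_pos.1 (hs0.trans hsp)
  have hkp : k ≤ p := by
    have : ((k : ℕ) : ℝ) < p + 1 := by linarith
    exact Nat.lt_succ_iff.1 (by exact_mod_cast this)
  have hp1' : (1 : ℝ) ≤ p := by exact_mod_cast hp1
  have hf := h.2.2.2.2.1 m le_rfl
  set f := iteratedDeriv m (caputoR k α 1 ω) with hfdef
  set μ := min (2 * α) (α + m - 1 / 2) with hμ
  rw [endpoint_functional_eq hp1 hα0 hs0 hf (fun i => c i * L i) d (hT.le.trans hkp) hω, abs_neg]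
  have hq0 : (0 : ℝ) ≤ (p : ℝ) ^ (-μ) := by positivity
  have e1 : |∑ i ∈ Finset.range m, c i * L i * ((α + i) * polyFracInt (α + i) (legendreP p) 1)| ≤
      D * (p : ℝ) ^ (-μ) * ∑ i ∈ Finset.range m, |L i| := by
    rw [Finset.mul_sum]
    refine (Finset.abs_sum_le_sum_abs _ _).trans (Finset.sum_le_sum fun i hi => ?_)
    have h1 : |polyFracInt (α + i) (legendreP p) 1| ≤ C₂ i * (p : ℝ) ^ (-μ) := by
      refine (hb₂ i p hp1).trans (mul_le_mul_of_nonneg_left ?_ (hC₂ i).le)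
      refine Real.rpow_le_rpow_of_exponent_le hp1' ?_
      have : μ ≤ 2 * α := min_le_left _ _
      linarith [(Nat.cast_nonneg i : (0 : ℝ) ≤ i)]
    rw [abs_mul, abs_mul, abs_mul, abs_of_pos (hpos i)]
    calc _ ≤ |c i| * |L i| * ((α + i) * (C₂ i * (p : ℝ) ^ (-μ))) := by
          have := (hpos i).le
          gcongr
      _ = |c i| * ((α + i) * C₂ i) * (p : ℝ) ^ (-μ) * |L i| := by ring
      _ ≤ _ := by
        have := hD i hi
        gcongr
  have e2 : |∫ y in (-1 : ℝ)..1, polyFracInt s (legendreP p) y * f y| ≤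
      C₁ * (p : ℝ) ^ (-μ) * ∫ y in (-1 : ℝ)..1, |f y| := by
    rw [← intervalIntegral.integral_const_mul, ← Real.norm_eq_abs]
    refine intervalIntegral.norm_integral_le_of_norm_le (by norm_num)
      (ae_of_all _ fun y hy => ?_) (hf.abs.const_mul _)
    rw [norm_mul, Real.norm_eq_abs, Real.norm_eq_abs]
    refine mul_le_mul_of_nonneg_right ((hb₁ p hsp y (Ioc_subset_Icc_self hy)).trans ?_)
      (abs_nonneg _)
    refine mul_le_mul_of_nonneg_left (Real.rpow_le_rpow_of_exponent_le hp1' ?_) hC₁.le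
    refine neg_le_neg (min_le_min ?_ ?_) <;> linarith
  have hI0 : 0 ≤ ∫ y in (-1 : ℝ)..1, |f y| :=
    intervalIntegral.integral_nonneg (by norm_num) fun _ _ => abs_nonneg _
  have hL0 : 0 ≤ ∑ i ∈ Finset.range m, |L i| := Finset.sum_nonneg fun _ _ => abs_nonneg _
  have hU : UsemiR k m α ω L = (∫ y in (-1 : ℝ)..1, |f y|) + ∑ i ∈ Finset.range m, |L i| := rfl
  rw [hU]
  set I := ∫ y in (-1 : ℝ)..1, |f y|
  set S := ∑ i ∈ Finset.range m, |L i|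
  calc _ ≤ D * (p : ℝ) ^ (-μ) * S + |d| * (s * (C₁ * (p : ℝ) ^ (-μ) * I)) := by
        refine (abs_add_le _ _).trans (add_le_add e1 ?_)
        rw [abs_mul, abs_mul, abs_of_pos hs0]
        gcongr
    _ ≤ _ := by
      have h1 : 0 ≤ D * (p : ℝ) ^ (-μ) * I := by positivity
      have h2 : 0 ≤ |d| * (s * C₁) * (p : ℝ) ^ (-μ) * S := by positivity
      have h3 : 0 ≤ (p : ℝ) ^ (-μ) * (I + S) := by positivity
      linarith

/-- endpoint estimates for the Gauss–Radau projections `Π_p^±` of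
`ω ∈ 𝒰^{α,m}_{1−}((−1,1))` (right-endpoint singularity). -/
theorem stmt_12 (k m : ℕ) (hk : 1 ≤ k) (hm : 1 ≤ m) (α : ℝ)
    (hα1 : (k : ℝ) - 1 < α) (hα2 : α < (k : ℝ)) (hαint : ∀ j : ℤ, α ≠ (j : ℝ))
    (hαm : 1 / 2 < α + (m : ℝ)) :
    ∃ C > (0 : ℝ), ∀ p : ℕ, α + (m : ℝ) < (p : ℝ) + 1 →
      ∀ (ω : ℝ → ℝ) (L : ℕ → ℝ), MemUR k m α ω L →
        (∀ P : Polynomial ℝ, P.natDegree ≤ p →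
          (∀ v : Polynomial ℝ, v.natDegree < p →
              ∫ x in (-1 : ℝ)..1, (P.eval x - ω x) * v.eval x = 0) →
          P.eval 1 = ω 1 →
          |ω (-1) - P.eval (-1)| ≤
            C * (p : ℝ) ^ (-(min (2 * α) (α + (m : ℝ) - 1 / 2))) *
              UsemiR k m α ω L) ∧
        (∀ P : Polynomial ℝ, P.natDegree ≤ p →
          (∀ v : Polynomial ℝ, v.natDegree < p →
              ∫ x in (-1 : ℝ)..1, (P.eval x - ω x) * v.eval x = 0) →
          P.eval (-1) = ω (-1) →
          |ω 1 - P.eval 1| ≤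
            C * (p : ℝ) ^ (-(min (2 * α) (α + (m : ℝ) - 1 / 2))) *
              UsemiR k m α ω L) := by
  obtain ⟨C, hC, hbound⟩ := exists_abs_endpoint_functional_le k m hk hm α hα1 hα2 hαint
  refine ⟨C, hC, fun p hp ω L h => ?_⟩
  have hk1 : (1 : ℝ) ≤ k := by exact_mod_cast hk
  have hm1 : (1 : ℝ) ≤ m := by exact_mod_cast hm
  have hp1 : 1 ≤ p := Nat.cast_pos.1 (by linarith : (0 : ℝ) < p)
  refine ⟨fun P hP horth hP1 => ?_, fun P hP horth hP1 => ?_⟩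
  · have e := endpoint_errors_eq hp1 h.1 hP horth
    refine le_of_eq_of_le ?_ (hbound p hp ω L h)
    rw [← e, hP1, sub_self, zero_sub, abs_neg, abs_mul, abs_pow, abs_neg, abs_one, one_pow, one_mul]
  · have e := endpoint_errors_eq hp1 h.1 hP horth
    refine le_of_eq_of_le ?_ (hbound p hp ω L h)
    rw [← e, hP1, sub_self, mul_zero, sub_zero]
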